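/- arXiv:math/0512080 — 4 statements merged into one kernel-verified Lean document; each statement's English description precedes it below -/
import Mathlib

section
/- Let G and F be symmetric positive finite measures on ℝ such that for all z ∈ ℂ∖[0,∞), z·∫_ℝ (1+t²)/(1−zt²) dG(t) = z·∫_ℝ (1+t²)/(1−zt²) dF(t). Then G = F. -/
open MeasureTheory Complex Filter Set Real

/-- The function `C^{(G)}(z) = z ∫ (1+t²)/(1-zt²) dG(t)` associated with a positive
finite measure `G` on `ℝ`. -/
noncomputable def Cmeas (G : Measure ℝ) (z : ℂ) : ℂ :=
  z * ∫ t : ℝ, (1 + (t:ℂ)^2) / (1 - z * (t:ℂ)^2) ∂G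

/-- Integration of a power series in a random variable bounded by one. -/
lemma hasSum_mul_integral_pow {Ω : Type*} [MeasurableSpace Ω] {μ : Measure Ω} [IsFiniteMeasure μ]
    {X : Ω → ℝ} (hX : Measurable X) (hX1 : ∀ ω, |X ω| ≤ 1) {a : ℕ → ℂ}
    (ha : Summable fun n => ‖a n‖) :
    HasSum (fun n => a n * ∫ ω, (X ω : ℂ) ^ n ∂μ) (∫ ω, ∑' n, a n * (X ω : ℂ) ^ n ∂μ) := by
  have hbound (n : ℕ) (ω : Ω) : ‖a n * (X ω : ℂ) ^ n‖ ≤ ‖a n‖ := by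
    rw [norm_mul, norm_pow, Complex.norm_real]
    exact mul_le_of_le_one_right (norm_nonneg _) (pow_le_one₀ (norm_nonneg _) (hX1 ω))
  simp_rw [← integral_const_mul]
  refine hasSum_integral_of_dominated_convergence (fun n _ => ‖a n‖)
    (fun n => by fun_prop) (fun n => ae_of_all _ (hbound n)) (ae_of_all _ fun _ => ha)
    (integrable_const _) (ae_of_all _ fun ω => ?_)
  exact (Summable.of_norm_bounded ha fun n => hbound n ω).hasSum

/-- A power series vanishing on the open unit disc has zero coefficients. -/
lemma eq_zero_of_hasSum_mul_pow_zero {d : ℕ → ℂ} (hd : ∀ y : ℂ, ‖y‖ < 1 →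
    HasSum (fun n => y ^ n * d n) 0) : d = 0 := by
  have hps : HasFPowerSeriesOnBall (0 : ℂ → ℂ) (FormalMultilinearSeries.ofScalars ℂ d) 0 1 := by
    refine ⟨?_, one_pos, fun {y} hy => ?_⟩
    · refine ENNReal.le_of_forall_nnreal_lt fun r hr => ?_
      refine FormalMultilinearSeries.le_radius_of_tendsto (l := 0) _ ?_
      have hr' : ‖((r : ℝ) : ℂ)‖ < 1 := by simpa using hr
      have := (hd _ hr').summable.tendsto_atTop_zero.norm
      simpa [FormalMultilinearSeries.ofScalars_norm, mul_comm] using this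
    · have hy' : ‖y‖ < 1 := by
        rwa [Metric.mem_eball, edist_zero_right, ← ofReal_norm, ENNReal.ofReal_lt_one] at hy
      simpa [FormalMultilinearSeries.ofScalars_apply_eq, mul_comm] using hd y hy'
  have h0 := hps.hasFPowerSeriesAt.eq_zero
  exact (FormalMultilinearSeries.ofScalars_series_eq_zero ℂ).1 h0

/-- The resolvent integrals near the origin determine the moments of a bounded random variable. -/
lemma integral_pow_eq_of_integral_inv_eq {Ω : Type*} [MeasurableSpace Ω] {μ ν : Measure Ω}
    [IsFiniteMeasure μ] [IsFiniteMeasure ν] {X : Ω → ℝ} (hX : Measurable X)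
    (hX1 : ∀ ω, |X ω| ≤ 1)
    (h : ∀ y : ℂ, ‖y‖ < 1 → ∫ ω, (1 - y * X ω)⁻¹ ∂μ = ∫ ω, (1 - y * X ω)⁻¹ ∂ν) (n : ℕ) :
    ∫ ω, (X ω : ℂ) ^ n ∂μ = ∫ ω, (X ω : ℂ) ^ n ∂ν := by
  refine sub_eq_zero.1 (congrFun (eq_zero_of_hasSum_mul_pow_zero (d := fun n =>
    ∫ ω, (X ω : ℂ) ^ n ∂μ - ∫ ω, (X ω : ℂ) ^ n ∂ν) fun y hy => ?_) n)
  have hsum : Summable fun n => ‖y ^ n‖ := by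
    simpa using summable_geometric_of_lt_one (norm_nonneg y) hy
  have hgeom (ω : Ω) : ∑' n, y ^ n * (X ω : ℂ) ^ n = (1 - y * X ω)⁻¹ := by
    simp_rw [← mul_pow]
    refine tsum_geometric_of_norm_lt_one ?_
    rw [norm_mul, Complex.norm_real]
    exact (mul_le_of_le_one_right (norm_nonneg y) (hX1 ω)).trans_lt hy
  have hdiff := (hasSum_mul_integral_pow (μ := μ) hX hX1 hsum).sub
    (hasSum_mul_integral_pow (μ := ν) hX hX1 hsum)
  simp_rw [hgeom, h y hy, sub_self] at hdiff
  simpa [mul_sub] using hdiff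

/-- The moments of a random variable bounded by one determine its distribution. -/
lemma map_eq_map_of_integral_pow_eq {Ω : Type*} [MeasurableSpace Ω] {μ ν : Measure Ω}
    [IsFiniteMeasure μ] [IsFiniteMeasure ν] {X : Ω → ℝ} (hX : Measurable X)
    (hX1 : ∀ ω, |X ω| ≤ 1)
    (h : ∀ n : ℕ, ∫ ω, (X ω : ℂ) ^ n ∂μ = ∫ ω, (X ω : ℂ) ^ n ∂ν) : μ.map X = ν.map X := by
  refine Measure.ext_of_charFun (funext fun s => ?_)
  have hsum : Summable fun n : ℕ => ‖(s * I) ^ n / (n.factorial : ℂ)‖ :=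
    NormedSpace.norm_expSeries_div_summable (s * I)
  have hexp (ω : Ω) : ∑' n : ℕ, (s * I) ^ n / (n.factorial : ℂ) * (X ω : ℂ) ^ n =
      Complex.exp (s * X ω * I) := by
    rw [Complex.exp_eq_exp_ℂ, NormedSpace.exp_eq_tsum_div]
    refine tsum_congr fun n => ?_
    ring
  have hchar (ρ : Measure Ω) [IsFiniteMeasure ρ] :
      HasSum (fun n : ℕ => (s * I) ^ n / (n.factorial : ℂ) * ∫ ω, (X ω : ℂ) ^ n ∂ρ)
        (charFun (ρ.map X) s) := by
    rw [charFun_apply_real, integral_map hX.aemeasurable (by fun_prop)]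
    simpa only [hexp] using hasSum_mul_integral_pow (μ := ρ) hX hX1 hsum
  refine (hchar μ).unique ?_
  simpa only [h] using hchar ν

/-- A symmetric measure on the line is determined by its image under the absolute value. -/
lemma eq_of_map_abs_eq {μ ν : Measure ℝ} (hμ : μ.map (fun x => -x) = μ)
    (hν : ν.map (fun x => -x) = ν) (h : μ.map (fun x => |x|) = ν.map (fun x => |x|)) :
    μ = ν := by
  ext B hB
  have hg : Measurable fun x : ℝ => B.indicator (1 : ℝ → ENNReal) x := measurable_one.indicator hB
  have hdouble (ρ : Measure ℝ) (hρ : ρ.map (fun x => -x) = ρ) :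
      2 * ρ B = ∫⁻ x, B.indicator 1 x + B.indicator 1 (-x) ∂ρ.map (fun x => |x|) := by
    rw [lintegral_map (by fun_prop) (by fun_prop)]
    have habs (x : ℝ) : B.indicator (1 : ℝ → ENNReal) |x| + B.indicator 1 (-|x|) =
        B.indicator 1 x + B.indicator 1 (-x) := by
      rcases abs_choice x with hx | hx <;> simp [hx, add_comm]
    have hneg : ∫⁻ x, B.indicator (1 : ℝ → ENNReal) (-x) ∂ρ = ρ B := by
      rw [← lintegral_map (μ := ρ) hg measurable_neg, hρ, lintegral_indicator_one hB]
    simp_rw [habs]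
    rw [lintegral_add_left hg, hneg, lintegral_indicator_one hB, two_mul]
  have h2 : 2 * μ B = 2 * ν B := by rw [hdouble μ hμ, hdouble ν hν, h]
  exact (ENNReal.mul_right_inj two_ne_zero ENNReal.ofNat_ne_top).1 h2

lemma abs_sq_div_one_add_sq_le_one (t : ℝ) : |t ^ 2 / (1 + t ^ 2)| ≤ 1 := by
  rw [abs_of_nonneg (by positivity), div_le_one (by positivity)]
  linarith

lemma abs_eq_sqrt_sq_div_one_add_sq (t : ℝ) :
    |t| = √((t ^ 2 / (1 + t ^ 2)) / (1 - t ^ 2 / (1 + t ^ 2))) := by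
  have ht : 1 + t ^ 2 ≠ 0 := by positivity
  have hsq : (t ^ 2 / (1 + t ^ 2)) / (1 - t ^ 2 / (1 + t ^ 2)) = t ^ 2 := by
    rw [one_sub_div ht, add_sub_cancel_right]
    field_simp
  rw [hsq, Real.sqrt_sq_eq_abs]

lemma Cmeas_eq_mul_integral_inv (G : Measure ℝ) (z : ℂ) :
    Cmeas G z = z * ∫ t : ℝ, (1 - (1 + z) * ((t ^ 2 / (1 + t ^ 2) : ℝ) : ℂ))⁻¹ ∂G := by
  rw [Cmeas]
  congr 2 with t
  have ht : (1 + (t : ℂ) ^ 2) ≠ 0 := by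
    exact_mod_cast (by positivity : (1 + t ^ 2 : ℝ) ≠ 0)
  rw [← inv_div]
  congr 1
  push_cast
  field_simp
  ring

/-- if two symmetric positive finite measures `G, F` on `ℝ` satisfy
`C^{(G)} = C^{(F)}` on `ℂ ∖ [0,∞)`, then `G = F`. -/
theorem stmt3 (G F : Measure ℝ) [IsFiniteMeasure G] [IsFiniteMeasure F]
    (hGsym : G.map (fun x => -x) = G) (hFsym : F.map (fun x => -x) = F)
    (h : ∀ z : ℂ, ¬(z.im = 0 ∧ 0 ≤ z.re) → Cmeas G z = Cmeas F z) :
    G = F := by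
  have hX : Measurable fun t : ℝ => t ^ 2 / (1 + t ^ 2) := by fun_prop
  have hmoments := integral_pow_eq_of_integral_inv_eq (μ := G) (ν := F) hX
    abs_sq_div_one_add_sq_le_one fun y hy => by
      have hre : y.re < 1 := (Complex.re_le_norm y).trans_lt hy
      have hz : y - 1 ≠ 0 := fun h0 => by
        rw [sub_eq_zero.1 h0] at hre
        simp at hre
      have hy1 := h (y - 1) (by
        rintro ⟨-, h0⟩
        simp only [Complex.sub_re, Complex.one_re] at h0
        linarith)
      rw [Cmeas_eq_mul_integral_inv, Cmeas_eq_mul_integral_inv] at hy1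
      simpa only [add_sub_cancel] using mul_left_cancel₀ hz hy1
  have hmap := map_eq_map_of_integral_pow_eq hX abs_sq_div_one_add_sq_le_one hmoments
  have hψ : Measurable fun v : ℝ => √(v / (1 - v)) := by fun_prop
  refine eq_of_map_abs_eq hGsym hFsym ?_
  simp_rw [abs_eq_sqrt_sq_div_one_add_sq]
  have hcomp := congrArg (Measure.map fun v : ℝ => √(v / (1 - v))) hmap
  rwa [Measure.map_map hψ hX, Measure.map_map hψ hX] at hcomp
end

section
/- Let λ ∈ [0,1] and let G be a symmetric positive finite measure on ℝ. Then there exist a symmetric probability measure μ on ℝ and β > 0 such that for every x ∈ (−β,0): T(C^{(G)}(x)) ≠ 0, the number x/T(C^{(G)}(x)) lies in ℂ∖[0,∞), and H_μ(x/T(C^{(G)}(x))) = x. (This expresses that μ is a ⊞_λ-infinitely divisible distribution whose rectangular R-transform with ratio λ equals C^{(G)}, i.e. whose Lévy measure is G.) -/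
open MeasureTheory Complex Filter Set Real

/-- The branch of the square root on `ℂ ∖ [0,∞)` with `√(-1) = i`. -/
noncomputable def sqrtCut (z : ℂ) : ℂ := Complex.I * (-z) ^ ((1:ℂ)/2)

/-- Cauchy transform of a measure on `ℝ`. -/
noncomputable def cauchyT (μ : Measure ℝ) (z : ℂ) : ℂ := ∫ t : ℝ, (z - (t:ℂ))⁻¹ ∂μ

/-- The function `H_μ(z) = λ G_μ(1/√z)² + (1-λ) √z G_μ(1/√z)`. -/
noncomputable def Hfun (l : ℝ) (μ : Measure ℝ) (z : ℂ) : ℂ :=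
  (l:ℂ) * (cauchyT μ (sqrtCut z)⁻¹)^2 + (1 - (l:ℂ)) * sqrtCut z * cauchyT μ (sqrtCut z)⁻¹

/-- The polynomial `T(X) = (λX+1)(X+1)`. -/
noncomputable def Tpoly (l : ℝ) (X : ℂ) : ℂ := ((l:ℂ) * X + 1) * (X + 1)

open scoped Topology NNReal in
/-- Sequential compactness of sub-probability measures on a compact space, in integrated form. -/
lemma exists_finiteMeasure_integral_eq_of_tendsto {X : Type*} [TopologicalSpace X] [CompactSpace X]
    [T2Space X] [MeasurableSpace X] [BorelSpace X] (σ : ℕ → FiniteMeasure X)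
    (hσ : ∀ n, (σ n).mass ≤ 1) :
    ∃ ρ : FiniteMeasure X, ρ.mass ≤ 1 ∧ ∀ (f : X → ℝ) (c : ℝ), Continuous f →
      Tendsto (fun n => ∫ v, f v ∂(σ n : Measure X)) atTop (𝓝 c) →
      ∫ v, f v ∂(ρ : Measure X) = c := by
  have hK := isCompact_setOfPred_finiteMeasure_le_of_compactSpace X (1 : ℝ≥0)
  obtain ⟨ρ, hρ, hlim⟩ := hK.ultrafilter_le_nhds ((hyperfilter ℕ).map σ) (by
    rw [Filter.le_principal_iff]
    exact Filter.Eventually.of_forall (f := (hyperfilter ℕ : Filter ℕ)) hσ)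
  refine ⟨ρ, hρ, fun f c hf hc => ?_⟩
  have hlim' : Tendsto σ (hyperfilter ℕ : Filter ℕ) (𝓝 ρ) := hlim
  rw [FiniteMeasure.tendsto_iff_forall_integral_tendsto] at hlim'
  have h1 := hlim' (BoundedContinuousFunction.mkOfCompact ⟨f, hf⟩)
  exact tendsto_nhds_unique h1 (hc.mono_left (Nat.hyperfilter_le_atTop))

lemma continuous_poisson_real {ζ : ℝ} (hζ : |ζ| < 1) :
    Continuous fun v : Icc (-1 : ℝ) 1 => (1 - ζ ^ 2) / (1 - 2 * ζ * (v : ℝ) + ζ ^ 2) := by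
  refine continuous_const.div (by fun_prop) ?_
  rintro ⟨v, hv1, hv2⟩
  have hlt := abs_lt.1 hζ
  have hpos : 0 < 1 - 2 * ζ * v + ζ ^ 2 := by
    rcases le_total 0 ζ with h | h
    · nlinarith [mul_nonneg h (sub_nonneg.2 hv2), pow_pos (sub_pos.2 hlt.2) 2]
    · nlinarith [mul_nonneg (neg_nonneg.2 h) (by linarith : 0 ≤ 1 + v),
        pow_pos (by linarith : 0 < 1 + ζ) 2]
  exact ne_of_gt hpos

/-- Poisson's formula on the circle, averaged over `θ ↦ -θ`: the Poisson kernel at a real point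
depends on the boundary point only through its real part. -/
lemma exists_finiteMeasure_poisson_of_diffContOnCl {h : ℂ → ℂ}
    (hd : DiffContOnCl ℂ h (Metric.ball 0 1)) (hpos : ∀ z ∈ Metric.sphere (0 : ℂ) 1, 0 ≤ (h z).re)
    (h0 : (h 0).re ≤ 1) :
    ∃ σ : FiniteMeasure (Icc (-1 : ℝ) 1), σ.mass ≤ 1 ∧ ∀ ζ : ℝ, |ζ| < 1 →
      ∫ v, (1 - ζ ^ 2) / (1 - 2 * ζ * (v : ℝ) + ζ ^ 2) ∂(σ : Measure (Icc (-1 : ℝ) 1))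
        = (h ζ).re := by
  have hcont : Continuous fun θ : ℝ => (h (circleMap 0 1 θ)).re := by
    have h1 : ContinuousOn h (Metric.closedBall 0 1) := by
      have := hd.continuousOn
      rwa [closure_ball _ one_ne_zero] at this
    exact Complex.continuous_re.comp (h1.comp_continuous (continuous_circleMap 0 1)
      fun θ => Metric.sphere_subset_closedBall (circleMap_mem_sphere 0 zero_le_one θ))
  set d : ℝ → ℝ := fun θ => (2 * π)⁻¹ * (h (circleMap 0 1 θ)).re with hd_def
  have hdc : Continuous d := hcont.const_mul _
  have hdpos : ∀ θ, 0 ≤ d θ := fun θ =>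
    mul_nonneg (by positivity) (hpos _ (circleMap_mem_sphere 0 zero_le_one θ))
  let c : ℝ → Icc (-1 : ℝ) 1 := fun θ => ⟨Real.cos θ, Real.neg_one_le_cos θ, Real.cos_le_one θ⟩
  have hc : Continuous c := by fun_prop
  let m : Measure ℝ := (volume.restrict (Ioc 0 (2 * π))).withDensity fun θ => ENNReal.ofReal (d θ)
  have hdi : IntegrableOn d (Ioc 0 (2 * π)) := hdc.integrableOn_Ioc
  have : IsFiniteMeasure m := isFiniteMeasure_withDensity_ofReal hdi.2
  have key : ∀ ζ : ℝ, |ζ| < 1 →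
      ∫ v, (1 - ζ ^ 2) / (1 - 2 * ζ * (v : ℝ) + ζ ^ 2) ∂(m.map c) = (h ζ).re := by
    intro ζ hζ
    have hζb : (ζ : ℂ) ∈ Metric.ball (0 : ℂ) 1 := by simpa using hζ
    rw [integral_map hc.measurable.aemeasurable (continuous_poisson_real hζ).aestronglyMeasurable,
      integral_withDensity_eq_integral_toReal_smul (by fun_prop) (by simp)]
    have hP := hd.circleAverage_poissonKernel_smul hζb
    have hP2 : (Real.circleAverage (Complex.reCLM ∘ (poissonKernel 0 (ζ : ℂ) • h)) 0 1)
        = (h ζ).re := by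
      rw [Complex.reCLM.circleAverage_comp_comm, hP]
      · rfl
      · rw [poissonKernel_eq_re_herglotzRieszKernel]
        apply ContinuousOn.circleIntegrable'
        apply ContinuousOn.smul
        · exact Complex.continuous_re.comp_continuousOn
            (continuousOn_herglotzRieszKernel_sphere hζb)
        · refine hd.continuousOn.mono ?_
          rw [closure_ball _ one_ne_zero, abs_one]
          exact Metric.sphere_subset_closedBall
    rw [← hP2, circleAverage_def, intervalIntegral.integral_of_le (by positivity),
      smul_eq_mul, ← integral_const_mul]
    refine integral_congr_ae (Eventually.of_forall fun θ => ?_)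
    have e1 : ‖circleMap 0 1 θ - (ζ : ℂ)‖ ^ 2 = 1 - 2 * ζ * Real.cos θ + ζ ^ 2 := by
      rw [← Complex.normSq_eq_norm_sq, Complex.normSq_apply]
      simp only [circleMap, zero_add, Complex.ofReal_one, one_mul, Complex.sub_re, Complex.sub_im,
        Complex.exp_ofReal_mul_I_re, Complex.exp_ofReal_mul_I_im, Complex.ofReal_re,
        Complex.ofReal_im]
      nlinarith [Real.sin_sq_add_cos_sq θ]
    dsimp only
    rw [ENNReal.toReal_ofReal (hdpos θ)]
    simp only [c, smul_eq_mul, Function.comp_apply,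
      Pi.smul_apply', Complex.reCLM_apply, Complex.real_smul, Complex.re_ofReal_mul,
      poissonKernel_def, sub_zero, e1, hd_def]
    simp
    ring
  have hmass : ((m.map c) univ).toReal ≤ 1 := by
    have := key 0 (by simp)
    simp at this
    rw [← Measure.real, this]
    exact h0
  have : IsFiniteMeasure (m.map c) := Measure.isFiniteMeasure_map m c
  refine ⟨⟨m.map c, inferInstance⟩, ?_, key⟩
  exact_mod_cast hmass

open scoped Topology in
/-- **Herglotz representation** on the real diameter. -/
lemma exists_finiteMeasure_poisson {h : ℂ → ℂ}
    (hd : DifferentiableOn ℂ h (Metric.ball 0 1)) (hpos : ∀ z ∈ Metric.ball (0 : ℂ) 1, 0 ≤ (h z).re)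
    (h0 : (h 0).re ≤ 1) :
    ∃ σ : FiniteMeasure (Icc (-1 : ℝ) 1), σ.mass ≤ 1 ∧ ∀ ζ : ℝ, |ζ| < 1 →
      ∫ v, (1 - ζ ^ 2) / (1 - 2 * ζ * (v : ℝ) + ζ ^ 2) ∂(σ : Measure (Icc (-1 : ℝ) 1))
        = (h ζ).re := by
  obtain ⟨r, -, hr, hr1⟩ := exists_seq_strictMono_tendsto' (zero_lt_one' ℝ)
  have hball : ∀ n, ∀ z ∈ Metric.closedBall (0 : ℂ) 1, (r n : ℂ) * z ∈ Metric.ball (0 : ℂ) 1 := by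
    intro n z hz
    have h1 := (hr n).1
    have h2 := (hr n).2
    simp only [mem_closedBall_zero_iff, mem_ball_zero_iff, norm_mul, Complex.norm_real,
      Real.norm_eq_abs, abs_of_pos h1] at hz ⊢
    nlinarith [norm_nonneg z]
  have hex := fun n => exists_finiteMeasure_poisson_of_diffContOnCl (h := fun z => h (r n * z))
    (DifferentiableOn.diffContOnCl (by
      rw [closure_ball _ one_ne_zero]
      exact hd.comp (by fun_prop) (hball n)))
    (fun z hz => hpos _ (hball n z (Metric.sphere_subset_closedBall hz))) (by simpa using h0)
  choose σ hσ1 hσ using hex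
  obtain ⟨ρ, hρ1, hρ⟩ := exists_finiteMeasure_integral_eq_of_tendsto σ hσ1
  refine ⟨ρ, hρ1, fun ζ hζ => hρ _ _ (continuous_poisson_real hζ) ?_⟩
  simp_rw [hσ _ ζ hζ]
  have hζb : (ζ : ℂ) ∈ Metric.ball (0 : ℂ) 1 := by simpa using hζ
  have hc : ContinuousAt h (ζ : ℂ) :=
    (hd.differentiableAt (Metric.isOpen_ball.mem_nhds hζb)).continuousAt
  have ht : Tendsto (fun n => (r n : ℂ) * ζ) atTop (𝓝 (ζ : ℂ)) := by
    have := ((Complex.continuous_ofReal.tendsto 1).comp hr1).mul_const (ζ : ℂ)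
    simpa using this
  exact (Complex.continuous_re.tendsto _).comp (hc.tendsto.comp ht)

/-- The integral `∫ (1+t²)/(1-zt²) dG(t)`, so that `C^{(G)}(z) = z * levyS G z`. -/
noncomputable def levyS (G : Measure ℝ) (z : ℂ) : ℂ :=
  ∫ t : ℝ, (1 + (t:ℂ)^2) / (1 - z * (t:ℂ)^2) ∂G

lemma one_sub_mul_ofReal_ne_zero {z : ℂ} (hz : -z ∈ slitPlane) {r : ℝ} (hr : 0 ≤ r) :
    1 - z * (r : ℂ) ≠ 0 := by
  intro h
  have h1 := congrArg Complex.re h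
  have h2 := congrArg Complex.im h
  simp at h1 h2
  rw [mem_slitPlane_iff] at hz
  simp at hz
  rcases h2 with h2 | h2
  · rcases hz with h | h
    · nlinarith
    · exact h h2
  · simp [h2] at h1

/-- Off `[0,∞)` the kernel `(1+t²)/(1-zt²)` is bounded, locally uniformly in `z`. -/
lemma exists_pos_mul_le_norm_one_sub {z₀ : ℂ} (hz : -z₀ ∈ slitPlane) :
    ∃ δ > 0, ∀ z ∈ Metric.ball z₀ δ, ∀ t : ℝ, δ * (1 + t ^ 2) ≤ ‖1 - z * (t : ℂ) ^ 2‖ := by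
  have hK : IsCompact (Set.image (fun τ : ℝ => ((1 - τ : ℝ) : ℂ) - z₀ * τ) (Icc 0 1)) :=
    isCompact_Icc.image (by fun_prop)
  have h0 : (0 : ℂ) ∉ (Set.image (fun τ : ℝ => ((1 - τ : ℝ) : ℂ) - z₀ * τ) (Icc 0 1)) := by
    rintro ⟨τ, ⟨h1, h2⟩, h⟩
    rcases h2.eq_or_lt with rfl | h2
    · simp at h
      simp [h] at hz
    · apply one_sub_mul_ofReal_ne_zero hz (r := τ / (1 - τ)) (div_nonneg h1 (by linarith))
      have h3 : ((1 - τ : ℝ) : ℂ) ≠ 0 := by exact_mod_cast (by linarith : 1 - τ ≠ 0)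
      dsimp only at h
      rw [Complex.ofReal_div]
      field_simp
      rw [h, mul_zero]
  obtain ⟨ε, hε, hball⟩ := Metric.mem_nhds_iff.1 (hK.isClosed.isOpen_compl.mem_nhds h0)
  refine ⟨ε / 2, by positivity, fun z hzb t => ?_⟩
  have ht : (0 : ℝ) < 1 + t ^ 2 := by positivity
  set τ : ℝ := t ^ 2 / (1 + t ^ 2) with hτ
  have hτ0 : 0 ≤ τ := by positivity
  have hτ1 : τ ≤ 1 := by rw [hτ, div_le_one ht]; linarith
  have hlow : ε ≤ ‖((1 - τ : ℝ) : ℂ) - z₀ * τ‖ := by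
    by_contra hlt
    push Not at hlt
    exact hball (by simpa using hlt) ⟨τ, ⟨hτ0, hτ1⟩, rfl⟩
  have hdiff : ‖(z - z₀) * τ‖ ≤ ε / 2 := by
    rw [norm_mul, Complex.norm_real, Real.norm_eq_abs, abs_of_nonneg hτ0]
    rw [Metric.mem_ball, dist_eq_norm] at hzb
    nlinarith [norm_nonneg (z - z₀)]
  have htri : ε / 2 ≤ ‖((1 - τ : ℝ) : ℂ) - z * τ‖ := by
    have := norm_sub_norm_le (((1 - τ : ℝ) : ℂ) - z₀ * τ) ((z - z₀) * τ)
    rw [show ((1 - τ : ℝ) : ℂ) - z₀ * τ - (z - z₀) * τ = ((1 - τ : ℝ) : ℂ) - z * τ by ring] at this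
    linarith
  have heq : 1 - z * (t : ℂ) ^ 2 = ((1 + t ^ 2 : ℝ) : ℂ) * (((1 - τ : ℝ) : ℂ) - z * τ) := by
    have : ((1 + t ^ 2 : ℝ) : ℂ) ≠ 0 := by exact_mod_cast ht.ne'
    rw [hτ]
    push_cast at this ⊢
    field_simp
    ring
  rw [heq, norm_mul, Complex.norm_real, Real.norm_eq_abs, abs_of_pos ht, mul_comm]
  gcongr

lemma norm_levy_kernel_le {δ : ℝ} (hδ : 0 < δ) {z : ℂ} {t : ℝ}
    (h : δ * (1 + t ^ 2) ≤ ‖1 - z * (t : ℂ) ^ 2‖) :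
    ‖(1 + (t:ℂ)^2) / (1 - z * (t:ℂ)^2)‖ ≤ δ⁻¹ := by
  have ht : (0 : ℝ) < 1 + t ^ 2 := by positivity
  have h1 : ‖(1 + (t:ℂ)^2)‖ = 1 + t ^ 2 := by
    rw [show (1 + (t:ℂ)^2) = ((1 + t ^ 2 : ℝ) : ℂ) by push_cast; ring, Complex.norm_real,
      Real.norm_eq_abs, abs_of_pos ht]
  rw [norm_div, h1, div_le_iff₀ (lt_of_lt_of_le (by positivity) h), inv_mul_eq_div,
    le_div_iff₀ hδ]
  linarith

lemma integrable_levy_kernel (G : Measure ℝ) [IsFiniteMeasure G] {z : ℂ} (hz : -z ∈ slitPlane) :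
    Integrable (fun t : ℝ => (1 + (t:ℂ)^2) / (1 - z * (t:ℂ)^2)) G := by
  obtain ⟨δ, hδ, h⟩ := exists_pos_mul_le_norm_one_sub hz
  exact Integrable.of_bound (Measurable.aestronglyMeasurable (by fun_prop)) δ⁻¹
    (Eventually.of_forall fun t => norm_levy_kernel_le hδ (h z (Metric.mem_ball_self hδ) t))

lemma differentiableAt_levyS (G : Measure ℝ) [IsFiniteMeasure G] {z : ℂ} (hz : -z ∈ slitPlane) :
    DifferentiableAt ℂ (levyS G) z := by
  obtain ⟨δ, hδ, h⟩ := exists_pos_mul_le_norm_one_sub hz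
  have key := hasDerivAt_integral_of_dominated_loc_of_deriv_le (μ := G) (𝕜 := ℂ)
    (F := fun (z : ℂ) (t : ℝ) => (1 + (t:ℂ)^2) / (1 - z * (t:ℂ)^2))
    (F' := fun (z : ℂ) (t : ℝ) =>
      ((1 + (t:ℂ)^2) / (1 - z * (t:ℂ)^2)) * ((t:ℂ)^2 / (1 - z * (t:ℂ)^2)))
    (x₀ := z) (bound := fun _ => δ⁻¹ * δ⁻¹) (Metric.ball_mem_nhds z hδ)
    (Eventually.of_forall fun w => Measurable.aestronglyMeasurable (by fun_prop))
    (integrable_levy_kernel G hz)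
    (Measurable.aestronglyMeasurable (by fun_prop))
    (Eventually.of_forall fun t w hw => ?_) (by fun_prop) (Eventually.of_forall fun t w hw => ?_)
  · exact key.2.differentiableAt
  · have hle := h w hw t
    have h1 := norm_levy_kernel_le hδ hle
    have h2 : ‖(t:ℂ)^2 / (1 - w * (t:ℂ)^2)‖ ≤ δ⁻¹ := by
      have hp : 0 < δ * (1 + t ^ 2) := by positivity
      rw [norm_div, norm_pow, Complex.norm_real, Real.norm_eq_abs, sq_abs,
        div_le_iff₀ (hp.trans_le hle), inv_mul_eq_div, le_div_iff₀ hδ]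
      nlinarith
    rw [norm_mul]
    gcongr
  · have hne : 1 - w * (t:ℂ)^2 ≠ 0 := by
      have hp : 0 < δ * (1 + t ^ 2) := by positivity
      exact norm_pos_iff.1 (hp.trans_le (h w hw t))
    have h1 : HasDerivAt (fun w : ℂ => 1 - w * (t:ℂ)^2) (-(t:ℂ)^2) w := by
      simpa using ((hasDerivAt_id w).mul_const ((t:ℂ)^2)).const_sub 1
    refine ((hasDerivAt_const w (1 + (t:ℂ)^2)).div h1 hne).congr_deriv ?_
    rw [div_mul_div_comm, sq (1 - w * (t:ℂ)^2)]
    ring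

lemma neg_mul_mem_slitPlane {a b : ℂ} (ha : a.im < 0) (hb : b.im < 0) :
    -(a * b) ∈ slitPlane := by
  rw [mem_slitPlane_iff]
  by_contra hcon
  push Not at hcon
  simp at hcon
  obtain ⟨h1, h2⟩ := hcon
  have h3 : b.im * (a.re ^ 2 + a.im ^ 2) = - a.im * (a.re * b.re - a.im * b.im) := by
    linear_combination -a.re * h2
  have h4 : 0 < a.re ^ 2 + a.im ^ 2 := by nlinarith [sq_nonneg a.re, mul_pos_of_neg_of_neg ha ha]
  nlinarith [mul_neg_of_neg_of_pos hb h4]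

lemma im_inv_neg {w : ℂ} (hw : 0 < w.im) : (w⁻¹).im < 0 := by
  have : w ≠ 0 := by rintro rfl; simp at hw
  rw [Complex.inv_im]
  exact div_neg_of_neg_of_pos (by linarith) (Complex.normSq_pos.2 this)

lemma im_inv_pos {w : ℂ} (hw : w.im < 0) : 0 < (w⁻¹).im := by
  have : w ≠ 0 := by rintro rfl; simp at hw
  rw [Complex.inv_im]
  exact div_pos (by linarith) (Complex.normSq_pos.2 this)

/-- The map `b ↦ b · S(ab)` preserves the lower half-plane. -/
lemma im_mul_levyS_nonpos (G : Measure ℝ) [IsFiniteMeasure G] {a b : ℂ} (ha : a.im < 0)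
    (hb : b.im < 0) : (b * levyS G (a * b)).im ≤ 0 := by
  have hab := neg_mul_mem_slitPlane ha hb
  have hint := (integrable_levy_kernel G hab).const_mul b
  have hb0 : b ≠ 0 := by rintro rfl; simp at hb
  rw [levyS, ← integral_const_mul]
  have := Complex.imCLM.integral_comp_comm hint
  rw [Complex.imCLM_apply] at this
  rw [← this]
  refine integral_nonpos fun t => ?_
  have hne := one_sub_mul_ofReal_ne_zero hab (sq_nonneg t)
  have hD : 0 < (b⁻¹ - a * ((t ^ 2 : ℝ) : ℂ)).im := by
    have := im_inv_pos hb
    simp only [Complex.sub_im, Complex.im_mul_ofReal]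
    nlinarith [mul_nonneg (neg_nonneg.2 ha.le) (sq_nonneg t)]
  have hD0 : b⁻¹ - a * ((t ^ 2 : ℝ) : ℂ) ≠ 0 := by intro h; rw [h] at hD; simp at hD
  have heq : b * ((1 + (t:ℂ)^2) / (1 - a * b * (t:ℂ)^2))
      = ((1 + t ^ 2 : ℝ) : ℂ) * (b⁻¹ - a * ((t ^ 2 : ℝ) : ℂ))⁻¹ := by
    have : b⁻¹ - a * ((t ^ 2 : ℝ) : ℂ) = (1 - a * b * ((t ^ 2 : ℝ) : ℂ)) * b⁻¹ := by
      field_simp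
    rw [this]
    push_cast at hne ⊢
    field_simp
  simp only [Complex.imCLM_apply, Pi.zero_apply]
  rw [heq, Complex.im_ofReal_mul]
  exact mul_nonpos_of_nonneg_of_nonpos (by positivity) (im_inv_neg hD).le

/-- Iterates approximating the Cauchy transform `a` that solves `1/a = w - b S(ab)` with
`b = λ a + (1-λ)/w`. -/
noncomputable def cauchyIter (l : ℝ) (G : Measure ℝ) : ℕ → ℂ → ℂ
  | 0, w => w⁻¹
  | n + 1, w => (w - (l * cauchyIter l G n w + (1 - l) * w⁻¹) *
      levyS G (cauchyIter l G n w * (l * cauchyIter l G n w + (1 - l) * w⁻¹)))⁻¹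

lemma im_convexComb_neg {l : ℝ} (hl : l ∈ Icc (0 : ℝ) 1) {a c : ℂ} (ha : a.im < 0)
    (hc : c.im < 0) : (l * a + (1 - l) * c).im < 0 := by
  have h : (l * a + (1 - l) * c).im = l * a.im + (1 - l) * c.im := by simp
  rw [h]
  rcases hl.1.eq_or_lt with rfl | h0
  · simpa
  · nlinarith [mul_neg_of_pos_of_neg h0 ha, mul_nonneg (sub_nonneg.2 hl.2) (neg_nonneg.2 hc.le)]

lemma cauchyIter_im_neg_and_differentiableAt {l : ℝ} (hl : l ∈ Icc (0 : ℝ) 1) (G : Measure ℝ)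
    [IsFiniteMeasure G] (n : ℕ) {w : ℂ} (hw : 0 < w.im) :
    (cauchyIter l G n w).im < 0 ∧ DifferentiableAt ℂ (cauchyIter l G n) w := by
  have hw0 : w ≠ 0 := by rintro rfl; simp at hw
  induction n with
  | zero => exact ⟨im_inv_neg hw, differentiableAt_inv hw0⟩
  | succ n ih =>
    obtain ⟨ha, hd⟩ := ih
    have hb := im_convexComb_neg hl ha (im_inv_neg hw)
    have him := im_mul_levyS_nonpos G ha hb
    have hpos : 0 < (w - (l * cauchyIter l G n w + (1 - l) * w⁻¹) *
      levyS G (cauchyIter l G n w * (l * cauchyIter l G n w + (1 - l) * w⁻¹))).im := by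
      rw [Complex.sub_im]; linarith
    refine ⟨im_inv_neg hpos, ?_⟩
    have hbd : DifferentiableAt ℂ (fun w => l * cauchyIter l G n w + (1 - l) * w⁻¹) w :=
      (hd.const_mul _).add ((differentiableAt_inv hw0).const_mul _)
    have hS := (differentiableAt_levyS G (neg_mul_mem_slitPlane ha hb)).fun_comp' w (hd.mul hbd)
    exact (differentiableAt_id.sub (hbd.mul hS)).inv (fun h => hpos.ne' (by
      simpa using congrArg Complex.im h))

/-- Values of `levyS` on the negative half-line: `levyS G (-x) = realS G x` for real `x`. -/
noncomputable def realS (G : Measure ℝ) (x : ℝ) : ℝ := ∫ t : ℝ, (1 + t ^ 2) / (1 + x * t ^ 2) ∂G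

lemma levyS_neg_ofReal (G : Measure ℝ) (x : ℝ) : levyS G (-(x : ℂ)) = (realS G x : ℂ) := by
  rw [levyS, realS, ← integral_complex_ofReal]
  congr 1 with t
  push_cast
  ring

lemma realS_nonneg (G : Measure ℝ) {x : ℝ} (hx : 0 ≤ x) : 0 ≤ realS G x :=
  integral_nonneg fun t => by positivity

lemma integrable_real_levy_kernel (G : Measure ℝ) [IsFiniteMeasure G] {x : ℝ} (hx : 0 < x) :
    Integrable (fun t : ℝ => (1 + t ^ 2) / (1 + x * t ^ 2)) G := by
  refine Integrable.of_bound (Measurable.aestronglyMeasurable (by fun_prop)) (1 + x⁻¹)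
    (Eventually.of_forall fun t => ?_)
  rw [Real.norm_eq_abs, abs_of_nonneg (by positivity), div_le_iff₀ (by positivity)]
  have : (1 + x⁻¹) * (1 + x * t ^ 2) = 1 + x⁻¹ + x * t ^ 2 + t ^ 2 := by field_simp; ring
  rw [this]
  have : 0 < x⁻¹ := by positivity
  nlinarith [mul_nonneg hx.le (sq_nonneg t)]

open scoped Topology in
lemma tendsto_mul_realS (G : Measure ℝ) [IsFiniteMeasure G] :
    Tendsto (fun x => x * realS G x) (𝓝[>] 0) (𝓝 0) := by
  have h : Tendsto (fun x : ℝ => ∫ t : ℝ, x * ((1 + t ^ 2) / (1 + x * t ^ 2)) ∂G) (𝓝[>] 0)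
      (𝓝 (∫ _ : ℝ, (0 : ℝ) ∂G)) := by
    refine tendsto_integral_filter_of_dominated_convergence (fun _ => (2 : ℝ))
      (Eventually.of_forall fun x => Measurable.aestronglyMeasurable (by fun_prop)) ?_
      (integrable_const _) (Eventually.of_forall fun t => ?_)
    · filter_upwards [self_mem_nhdsWithin, nhdsWithin_le_nhds (Iio_mem_nhds one_pos)] with x hx hx1
      have hx : 0 < x := hx
      have hx1 : x < 1 := hx1
      refine Eventually.of_forall fun t => ?_
      rw [Real.norm_eq_abs, abs_of_nonneg (by positivity), ← mul_div_assoc,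
        div_le_iff₀ (by positivity)]
      nlinarith [mul_nonneg hx.le (sq_nonneg t)]
    · have hc : ContinuousAt (fun x : ℝ => x * ((1 + t ^ 2) / (1 + x * t ^ 2))) 0 := by
        refine continuousAt_id.mul (continuousAt_const.div (by fun_prop) (by simp))
      simpa using hc.tendsto.mono_left nhdsWithin_le_nhds
  simpa [realS, integral_const_mul] using h

/-- One step of the iteration on the imaginary axis. -/
noncomputable def realStep (l : ℝ) (G : Measure ℝ) (s m : ℝ) : ℝ :=
  (1 + s ^ 2 * (l * m + (1 - l)) * realS G (s ^ 2 * (m * (l * m + (1 - l)))))⁻¹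

lemma convexComb_nonneg {l : ℝ} (hl : l ∈ Icc (0 : ℝ) 1) {m : ℝ} (hm : 0 ≤ m) :
    0 ≤ l * m + (1 - l) := by
  nlinarith [mul_nonneg hl.1 hm, hl.2]

lemma realStep_mem {l : ℝ} (hl : l ∈ Icc (0 : ℝ) 1) (G : Measure ℝ) {s m : ℝ} (hm : 0 ≤ m) :
    0 ≤ realStep l G s m ∧ realStep l G s m ≤ 1 := by
  have h1 := convexComb_nonneg hl hm
  have h2 := realS_nonneg G (x := s ^ 2 * (m * (l * m + (1 - l)))) (by positivity)
  constructor
  · rw [realStep]; positivity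
  · rw [realStep]
    exact inv_le_one_of_one_le₀ (le_add_of_nonneg_right (by positivity))

lemma realStep_iterate_mem {l : ℝ} (hl : l ∈ Icc (0 : ℝ) 1) (G : Measure ℝ) (s : ℝ) (n : ℕ) :
    0 ≤ (realStep l G s)^[n] 1 ∧ (realStep l G s)^[n] 1 ≤ 1 := by
  cases n with
  | zero => simp
  | succ n =>
    induction n with
    | zero => simpa using realStep_mem hl G (s := s) (m := 1) zero_le_one
    | succ n ih =>
      rw [Function.iterate_succ_apply']
      exact realStep_mem hl G ih.1

lemma cauchyIter_I_mul (l : ℝ) (G : Measure ℝ) {s : ℝ} (hs : 0 < s) (n : ℕ) :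
    cauchyIter l G n (I * (s : ℂ)⁻¹) = -I * s * ((realStep l G s)^[n] 1 : ℝ) := by
  have hs' : (s : ℂ) ≠ 0 := by exact_mod_cast hs.ne'
  have hw : (I * (s : ℂ)⁻¹)⁻¹ = -I * s := by
    rw [mul_inv, inv_inv, Complex.inv_I]
  induction n with
  | zero => rw [cauchyIter, hw]; simp
  | succ n ih =>
    rw [cauchyIter, ih, hw, Function.iterate_succ_apply']
    set m := (realStep l G s)^[n] 1
    have hb : (l : ℂ) * (-I * s * m) + (1 - l) * (-I * s) =
        -I * s * ((l * m + (1 - l) : ℝ) : ℂ) := by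
      push_cast; ring
    rw [hb]
    set B : ℝ := l * m + (1 - l) with hB
    have hab : -I * s * (m : ℂ) * (-I * s * (B : ℂ)) = -((s ^ 2 * (m * B) : ℝ) : ℂ) := by
      push_cast
      linear_combination (s * m * s * B : ℂ) * Complex.I_sq
    rw [hab, levyS_neg_ofReal, realStep, ← hB]
    set S := realS G (s ^ 2 * (m * B))
    have : I * (s : ℂ)⁻¹ - -I * s * (B : ℂ) * (S : ℂ)
        = (I * (s : ℂ)⁻¹) * ((1 + s ^ 2 * B * S : ℝ) : ℂ) := by
      push_cast
      field_simp
      ring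
    rw [this, mul_inv, hw, Complex.ofReal_inv]

/-- `realStep` is a contraction on `[1/2, 1]` when `s² S(s²)` is small. -/
lemma abs_realStep_sub_le {l : ℝ} (hl : l ∈ Icc (0 : ℝ) 1) (G : Measure ℝ) [IsFiniteMeasure G]
    {s m m' : ℝ} (hs : 0 < s) (hm : m ∈ Icc (1 / 2 : ℝ) 1) (hm' : m' ∈ Icc (1 / 2 : ℝ) 1) :
    |realStep l G s m - realStep l G s m'| ≤ 16 * (s ^ 2 * realS G (s ^ 2)) * |m - m'| := by
  have hB : 1 / 2 ≤ l * m + (1 - l) ∧ l * m + (1 - l) ≤ 1 := by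
    constructor <;> nlinarith [hl.1, hl.2, hm.1, hm.2]
  have hB' : 1 / 2 ≤ l * m' + (1 - l) ∧ l * m' + (1 - l) ≤ 1 := by
    constructor <;> nlinarith [hl.1, hl.2, hm'.1, hm'.2]
  have hBB : |(l * m + (1 - l)) - (l * m' + (1 - l))| ≤ |m - m'| := by
    rw [show (l * m + (1 - l)) - (l * m' + (1 - l)) = l * (m - m') by ring, abs_mul,
      abs_of_nonneg hl.1]
    exact mul_le_of_le_one_left (abs_nonneg _) hl.2
  unfold realStep
  set B := l * m + (1 - l)
  set B' := l * m' + (1 - l)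
  have hm0 : 0 < m := by linarith [hm.1]
  have hm0' : 0 < m' := by linarith [hm'.1]
  have hB0 : 0 < B := by linarith [hB.1]
  have hB0' : 0 < B' := by linarith [hB'.1]
  set φ := s ^ 2 * B * realS G (s ^ 2 * (m * B)) with hφ
  set φ' := s ^ 2 * B' * realS G (s ^ 2 * (m' * B')) with hφ'
  have h0 : 0 ≤ φ := mul_nonneg (by positivity) (realS_nonneg G (by positivity))
  have h0' : 0 ≤ φ' := mul_nonneg (by positivity) (realS_nonneg G (by positivity))
  have hinv : |(1 + φ)⁻¹ - (1 + φ')⁻¹| ≤ |φ - φ'| := by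
    rw [inv_sub_inv (by positivity) (by positivity), abs_div, abs_of_pos (a := (1 + φ) * (1 + φ'))
      (by positivity), show 1 + φ' - (1 + φ) = -(φ - φ') by ring, abs_neg]
    exact div_le_self (abs_nonneg _) (by nlinarith)
  refine hinv.trans ?_
  have hi := (integrable_real_levy_kernel G (x := s ^ 2 * (m * B)) (by positivity)).const_mul
    (s ^ 2 * B)
  have hi' := (integrable_real_levy_kernel G (x := s ^ 2 * (m' * B')) (by positivity)).const_mul
    (s ^ 2 * B')
  have hbound_int := (integrable_real_levy_kernel G (x := s ^ 2) (by positivity)).const_mul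
    (16 * s ^ 2 * |m - m'|)
  rw [hφ, hφ', realS, realS, ← integral_const_mul, ← integral_const_mul, ← integral_sub hi hi',
    show 16 * (s ^ 2 * realS G (s ^ 2)) * |m - m'| =
      16 * s ^ 2 * |m - m'| * realS G (s ^ 2) by ring,
    realS, ← integral_const_mul]
  refine abs_integral_le_integral_abs.trans
    (integral_mono (hi.sub hi').abs hbound_int fun t => ?_)
  set u := s ^ 2 * t ^ 2 with hu
  have hu0 : 0 ≤ u := by positivity
  have e1 : 1 + s ^ 2 * (m * B) * t ^ 2 = 1 + m * B * u := by rw [hu]; ring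
  have e2 : 1 + s ^ 2 * (m' * B') * t ^ 2 = 1 + m' * B' * u := by rw [hu]; ring
  dsimp only
  rw [e1, e2]
  have d1 : (1 + u) ≤ 4 * (1 + m * B * u) := by
    have : 1 / 2 * (1 / 2) ≤ m * B := mul_le_mul hm.1 hB.1 (by norm_num) hm0.le
    nlinarith [mul_le_mul_of_nonneg_right this hu0]
  have d2 : (1 + u) ≤ 4 * (1 + m' * B' * u) := by
    have : 1 / 2 * (1 / 2) ≤ m' * B' := mul_le_mul hm'.1 hB'.1 (by norm_num) hm0'.le
    nlinarith [mul_le_mul_of_nonneg_right this hu0]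
  have p1 : 0 < 1 + m * B * u := by positivity
  have p2 : 0 < 1 + m' * B' * u := by positivity
  have heq : s ^ 2 * B * ((1 + t ^ 2) / (1 + m * B * u)) -
      s ^ 2 * B' * ((1 + t ^ 2) / (1 + m' * B' * u))
      = s ^ 2 * (1 + t ^ 2) * (((B - B') + u * (B * B') * (m' - m)) /
        ((1 + m * B * u) * (1 + m' * B' * u))) := by
    field_simp
    ring
  rw [heq, abs_mul, abs_of_nonneg (by positivity : 0 ≤ s ^ 2 * (1 + t ^ 2)), abs_div,
    abs_of_pos (mul_pos p1 p2)]
  have hnum : |(B - B') + u * (B * B') * (m' - m)| ≤ (1 + u) * |m - m'| := by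
    refine (abs_add_le _ _).trans ?_
    rw [abs_mul, abs_of_nonneg (by positivity : 0 ≤ u * (B * B')), abs_sub_comm m' m]
    have : u * (B * B') ≤ u := mul_le_of_le_one_right hu0 (mul_le_one₀ hB.2 hB0'.le hB'.2)
    nlinarith [mul_le_mul_of_nonneg_right this (abs_nonneg (m - m'))]
  have hfrac : |(B - B') + u * (B * B') * (m' - m)| / ((1 + m * B * u) * (1 + m' * B' * u))
      ≤ 16 * |m - m'| / (1 + u) := by
    rw [div_le_div_iff₀ (mul_pos p1 p2) (by positivity)]
    have hq : (1 + u) * (1 + u) ≤ 16 * ((1 + m * B * u) * (1 + m' * B' * u)) := by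
      nlinarith [mul_le_mul d1 d2 (by positivity) (by positivity)]
    calc _ ≤ (1 + u) * |m - m'| * (1 + u) := by gcongr
      _ = |m - m'| * ((1 + u) * (1 + u)) := by ring
      _ ≤ |m - m'| * (16 * ((1 + m * B * u) * (1 + m' * B' * u))) := by gcongr
      _ = _ := by ring
  calc _ ≤ s ^ 2 * (1 + t ^ 2) * (16 * |m - m'| / (1 + u)) := by gcongr
    _ = _ := by ring

open scoped Topology in
/-- If `s² S(s²)` is small, the iteration converges to any fixed point in `[1/2, 1]`. -/
lemma tendsto_realStep_iterate {l : ℝ} (hl : l ∈ Icc (0 : ℝ) 1) (G : Measure ℝ) [IsFiniteMeasure G]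
    {s m : ℝ} (hs : 0 < s) (hsmall : 32 * (s ^ 2 * realS G (s ^ 2)) ≤ 1)
    (hm : m ∈ Icc (3 / 4 : ℝ) 1) (hfix : realStep l G s m = m) :
    Tendsto (fun n => (realStep l G s)^[n] 1) atTop (𝓝 m) := by
  have key : ∀ n, |(realStep l G s)^[n] 1 - m| ≤ (1 / 4) * (1 / 2) ^ n := by
    intro n
    induction n with
    | zero =>
      rw [Function.iterate_zero_apply, abs_le]
      constructor <;> norm_num <;> linarith [hm.1, hm.2]
    | succ n ih =>
      have hle : (1 / 4 : ℝ) * (1 / 2) ^ n ≤ 1 / 4 :=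
        mul_le_of_le_one_right (by norm_num) (pow_le_one₀ (by norm_num) (by norm_num))
      have hmem := (realStep_iterate_mem hl G s n).2
      have hab := abs_le.1 (ih.trans hle)
      rw [Function.iterate_succ_apply']
      have h1 := abs_realStep_sub_le hl G hs (m := (realStep l G s)^[n] 1) (m' := m)
        ⟨by linarith [hm.1], hmem⟩ ⟨by linarith [hm.1], hm.2⟩
      rw [hfix] at h1
      refine h1.trans ?_
      calc _ ≤ 1 / 2 * |(realStep l G s)^[n] 1 - m| := by gcongr; linarith
        _ ≤ 1 / 2 * (1 / 4 * (1 / 2) ^ n) := by gcongr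
        _ = 1 / 4 * (1 / 2) ^ (n + 1) := by ring
  rw [tendsto_iff_dist_tendsto_zero]
  refine squeeze_zero (g := fun n => 1 / 4 * (1 / 2) ^ n) (fun n => dist_nonneg) key ?_
  simpa using (tendsto_pow_atTop_nhds_zero_of_lt_one (r := (1 / 2 : ℝ)) (by norm_num)
    (by norm_num)).const_mul (1 / 4 : ℝ)

lemma im_cayley_pos {ζ : ℂ} (hζ : ζ ∈ Metric.ball (0 : ℂ) 1) :
    1 - ζ ≠ 0 ∧ 0 < (I * ((1 + ζ) / (1 - ζ))).im := by
  have hn : ‖ζ‖ < 1 := by simpa using hζ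
  have hne : 1 - ζ ≠ 0 := by
    intro h
    rw [← sub_eq_zero.1 h] at hn
    simp at hn
  refine ⟨hne, ?_⟩
  have hsq : ζ.re * ζ.re + ζ.im * ζ.im < 1 := by
    rw [← Complex.normSq_apply, Complex.normSq_eq_norm_sq]
    nlinarith [norm_nonneg ζ]
  have hD := Complex.normSq_pos.2 hne
  simp only [Complex.I_mul_im, Complex.div_re]
  rw [← add_div]
  refine div_pos ?_ hD
  simp
  nlinarith

open scoped Topology in
/-- A measure on `[-1,1]`, the compactified half-line `t² = (1+v)/(1-v)`, representing the limit of
the iteration. -/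
lemma exists_finiteMeasure_limit {l : ℝ} (hl : l ∈ Icc (0 : ℝ) 1) (G : Measure ℝ)
    [IsFiniteMeasure G] :
    ∃ σ : FiniteMeasure (Icc (-1 : ℝ) 1), ∀ s m : ℝ, 0 < s →
      Tendsto (fun n => (realStep l G s)^[n] 1) atTop (𝓝 m) →
      ∫ v, 2 / ((1 - (v : ℝ)) + s ^ 2 * (1 + v)) ∂(σ : Measure (Icc (-1 : ℝ) 1)) = m := by
  have hval : ∀ n (s : ℝ), 0 < s →
      (I * cauchyIter l G n (I * (s : ℂ)⁻¹)).re = s * (realStep l G s)^[n] 1 := by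
    intro n s hs
    rw [cauchyIter_I_mul l G hs, show I * (-I * s * ((realStep l G s)^[n] 1 : ℝ)) =
      ((s * (realStep l G s)^[n] 1 : ℝ) : ℂ) by
        push_cast
        linear_combination (-(s : ℂ) * ((realStep l G s)^[n] 1 : ℝ)) * Complex.I_sq,
      Complex.ofReal_re]
  have hex := fun n => exists_finiteMeasure_poisson
    (h := fun ζ => I * cauchyIter l G n (I * ((1 + ζ) / (1 - ζ)))) (by
      intro ζ hζ
      obtain ⟨hne, him⟩ := im_cayley_pos hζ
      have h1 := (cauchyIter_im_neg_and_differentiableAt hl G n him).2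
      have h2 : DifferentiableAt ℂ (fun ζ : ℂ => I * ((1 + ζ) / (1 - ζ))) ζ := by
        fun_prop (disch := exact hne)
      exact ((h1.fun_comp' ζ h2).const_mul I).differentiableWithinAt)
    (by
      intro ζ hζ
      have := (cauchyIter_im_neg_and_differentiableAt hl G n (im_cayley_pos hζ).2).1
      rw [Complex.I_mul_re]
      linarith)
    (by
      have h := hval n 1 one_pos
      simp only [Complex.ofReal_one, inv_one, one_mul] at h
      simp only [add_zero, sub_zero, div_one]
      rw [h]
      exact (realStep_iterate_mem hl G 1 n).2)
  choose σ hσ1 hσ using hex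
  obtain ⟨ρ, -, hρ⟩ := exists_finiteMeasure_integral_eq_of_tendsto σ hσ1
  refine ⟨ρ, fun s m hs hlim => ?_⟩
  set ζ : ℝ := (1 - s) / (1 + s) with hζ
  have hζ1 : |ζ| < 1 := by
    rw [hζ, abs_div, abs_of_pos (by linarith : 0 < 1 + s), div_lt_one (by linarith), abs_lt]
    constructor <;> linarith
  have hw : (1 + (ζ : ℂ)) / (1 - ζ) = (s : ℂ)⁻¹ := by
    have : (1 + ζ) / (1 - ζ) = s⁻¹ := by
      have h1 : 1 + s ≠ 0 := by positivity
      rw [hζ, show 1 + (1 - s) / (1 + s) = 2 / (1 + s) by field_simp; ring,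
        show 1 - (1 - s) / (1 + s) = 2 * s / (1 + s) by field_simp; ring]
      field_simp
    exact_mod_cast congrArg ((↑) : ℝ → ℂ) this
  have hlim' := hρ _ (s * m) (continuous_poisson_real hζ1) (by
    simp_rw [hσ _ ζ hζ1, hw, hval _ s hs]
    exact hlim.const_mul s)
  have hker : ∀ v : Icc (-1 : ℝ) 1, (1 - ζ ^ 2) / (1 - 2 * ζ * (v : ℝ) + ζ ^ 2)
      = s * (2 / ((1 - (v : ℝ)) + s ^ 2 * (1 + v))) := by
    intro v
    have h1 : 1 + s ≠ 0 := by positivity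
    rw [hζ, show 1 - ((1 - s) / (1 + s)) ^ 2 = 4 * s / (1 + s) ^ 2 by field_simp; ring,
      show 1 - 2 * ((1 - s) / (1 + s)) * (v : ℝ) + ((1 - s) / (1 + s)) ^ 2
        = 2 * ((1 - (v : ℝ)) + s ^ 2 * (1 + v)) / (1 + s) ^ 2 by field_simp; ring,
      div_div_div_cancel_right₀ (by positivity), mul_comm 2, ← div_div]
    ring
  simp_rw [hker] at hlim'
  rw [integral_const_mul] at hlim'
  exact mul_left_cancel₀ hs.ne' hlim'

open scoped Topology in
/-- Transport to `ℝ` of a measure on `[-1,1]` with no mass at the point at infinity `1`. -/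
lemma exists_isProbabilityMeasure_of_tendsto (σ : FiniteMeasure (Icc (-1 : ℝ) 1)) {s m : ℕ → ℝ}
    (hs : ∀ k, 0 < s k) (hs0 : Tendsto s atTop (𝓝 0)) (hm : Tendsto m atTop (𝓝 1))
    (h : ∀ k, ∫ v, 2 / ((1 - (v : ℝ)) + s k ^ 2 * (1 + v)) ∂(σ : Measure (Icc (-1 : ℝ) 1)) = m k) :
    ∃ μ : Measure ℝ, IsProbabilityMeasure μ ∧ ∀ r : ℝ, 0 < r →
      ∫ t : ℝ, (1 + r ^ 2 * t ^ 2)⁻¹ ∂μ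
        = ∫ v, 2 / ((1 - (v : ℝ)) + r ^ 2 * (1 + v)) ∂(σ : Measure (Icc (-1 : ℝ) 1)) := by
  have hden : ∀ (v : Icc (-1 : ℝ) 1) (r : ℝ), 0 < r → 0 < (1 - (v : ℝ)) + r ^ 2 * (1 + v) := by
    rintro ⟨v, hv1, hv2⟩ r hr
    dsimp only
    rcases hv2.eq_or_lt with rfl | hv
    · nlinarith [pow_pos hr 2]
    · nlinarith [mul_nonneg (pow_pos hr 2).le (by linarith : 0 ≤ 1 + v)]
  set D : Icc (-1 : ℝ) 1 → ENNReal := fun v => 2 / ENNReal.ofReal (1 - v) with hD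
  have hDm : Measurable D := by fun_prop
  set K : ℕ → Icc (-1 : ℝ) 1 → ENNReal :=
    fun k v => 2 / ENNReal.ofReal ((1 - (v : ℝ)) + s k ^ 2 * (1 + v)) with hK
  have hKm : ∀ k, Measurable (K k) := fun k => by fun_prop
  have hKint : ∀ k, ∫⁻ v, K k v ∂(σ : Measure (Icc (-1 : ℝ) 1)) = ENNReal.ofReal (m k) := by
    intro k
    have hc : Continuous fun v : Icc (-1 : ℝ) 1 => 2 / ((1 - (v : ℝ)) + s k ^ 2 * (1 + v)) :=
      continuous_const.div (by fun_prop) fun v => (hden v _ (hs k)).ne'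
    rw [← h k, ofReal_integral_eq_lintegral_ofReal
      (hc.integrable_of_hasCompactSupport (HasCompactSupport.of_compactSpace _))
      (Eventually.of_forall fun v => (div_pos two_pos (hden v _ (hs k))).le)]
    refine lintegral_congr fun v => ?_
    rw [ENNReal.ofReal_div_of_pos (hden v _ (hs k))]
    simp [hK]
  have hmE : Tendsto (fun k => ENNReal.ofReal (m k)) atTop (𝓝 1) := by
    simpa using ENNReal.tendsto_ofReal hm
  have hmass : ∫⁻ v, D v ∂(σ : Measure (Icc (-1 : ℝ) 1)) = 1 := by
    apply le_antisymm
    · have hpt : ∀ v, liminf (fun k => K k v) atTop = D v := by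
        intro v
        refine Tendsto.liminf_eq (ENNReal.Tendsto.const_div (ENNReal.tendsto_ofReal ?_)
          (Or.inr (by simp)))
        have := ((hs0.pow 2).mul_const (1 + (v : ℝ))).const_add (1 - (v : ℝ))
        simpa using this
      calc _ = ∫⁻ v, liminf (fun k => K k v) atTop ∂(σ : Measure (Icc (-1 : ℝ) 1)) := by
            simp_rw [hpt]
        _ ≤ liminf (fun k => ∫⁻ v, K k v ∂(σ : Measure (Icc (-1 : ℝ) 1))) atTop :=
            lintegral_liminf_le hKm
        _ = 1 := by simp_rw [hKint]; exact hmE.liminf_eq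
    · refine le_of_tendsto' hmE fun k => ?_
      rw [← hKint]
      refine lintegral_mono fun v => ENNReal.div_le_div_left (ENNReal.ofReal_le_ofReal ?_) _
      have := v.2.1
      nlinarith [mul_nonneg (pow_pos (hs k) 2).le (by linarith : 0 ≤ 1 + (v : ℝ))]
  have hfin : ∀ᵐ v ∂(σ : Measure (Icc (-1 : ℝ) 1)), D v < ⊤ :=
    ae_lt_top hDm (by simp [hmass])
  set τ : Icc (-1 : ℝ) 1 → ℝ := fun v => √((1 + v) / (1 - v)) with hτ
  have hτm : Measurable τ := by fun_prop
  refine ⟨((σ : Measure (Icc (-1 : ℝ) 1)).withDensity D).map τ, ?_, fun r hr => ?_⟩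
  · have : IsProbabilityMeasure ((σ : Measure (Icc (-1 : ℝ) 1)).withDensity D) :=
      ⟨by rw [withDensity_apply _ MeasurableSet.univ, setLIntegral_univ, hmass]⟩
    exact Measure.isProbabilityMeasure_map hτm.aemeasurable
  · rw [integral_map hτm.aemeasurable (Measurable.aestronglyMeasurable (by fun_prop)),
      integral_withDensity_eq_integral_toReal_smul hDm hfin]
    refine integral_congr_ae (hfin.mono fun v hv => ?_)
    have hv1 : 0 < 1 - (v : ℝ) := by
      by_contra hle
      simp only [hD, ENNReal.ofReal_of_nonpos (not_lt.1 hle)] at hv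
      rw [ENNReal.div_zero two_ne_zero] at hv
      exact lt_irrefl _ hv
    have hv2 : 0 ≤ 1 + (v : ℝ) := by linarith [v.2.1]
    have hp := hden v r hr
    simp only [hD, hτ, smul_eq_mul, ENNReal.toReal_div, ENNReal.toReal_ofReal hv1.le,
      ENNReal.toReal_ofNat]
    rw [Real.sq_sqrt (by positivity), show 1 + r ^ 2 * ((1 + (v : ℝ)) / (1 - v))
      = ((1 - (v : ℝ)) + r ^ 2 * (1 + v)) / (1 - v) by field_simp, inv_div]
    field_simp

lemma sqrtCut_neg_sq {s : ℝ} (hs : 0 ≤ s) : sqrtCut ((-(s ^ 2) : ℝ) : ℂ) = I * s := by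
  rw [sqrtCut, ← Complex.ofReal_neg, neg_neg,
    show ((1 : ℂ) / 2) = ((1 / 2 : ℝ) : ℂ) by push_cast; ring,
    ← Complex.ofReal_cpow (by positivity), ← Real.sqrt_eq_rpow, Real.sqrt_sq hs]

/-- The symmetrization `(μ + μ(-·))/2` of a measure on `ℝ`. -/
noncomputable def symmetrization (μ : Measure ℝ) : Measure ℝ :=
  (2⁻¹ : ENNReal) • (μ + μ.map fun x => -x)

lemma isProbabilityMeasure_symmetrization (μ : Measure ℝ) [IsProbabilityMeasure μ] :
    IsProbabilityMeasure (symmetrization μ) := by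
  have := Measure.isProbabilityMeasure_map (μ := μ) (f := fun x : ℝ => -x) (by fun_prop)
  constructor
  rw [symmetrization, Measure.smul_apply, Measure.add_apply, measure_univ, measure_univ,
    one_add_one_eq_two, smul_eq_mul]
  exact ENNReal.inv_mul_cancel (by simp) (by simp)

lemma map_neg_symmetrization (μ : Measure ℝ) :
    (symmetrization μ).map (fun x => -x) = symmetrization μ := by
  have hm : Measurable fun x : ℝ => -x := by fun_prop
  rw [symmetrization, Measure.map_smul, Measure.map_add _ _ hm, Measure.map_map hm hm,
    show ((fun x : ℝ => -x) ∘ fun x => -x) = id by ext; simp, Measure.map_id, add_comm]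

lemma cauchyT_symmetrization (μ : Measure ℝ) [IsProbabilityMeasure μ] {s : ℝ} (hs : 0 < s) :
    cauchyT (symmetrization μ) (I * s)⁻¹ =
      I * s * ((∫ t : ℝ, (1 + s ^ 2 * t ^ 2)⁻¹ ∂μ : ℝ) : ℂ) := by
  have hm : Measurable fun x : ℝ => -x := by fun_prop
  have := Measure.isProbabilityMeasure_map (μ := μ) hm.aemeasurable
  have hs' : (s : ℂ) ≠ 0 := by exact_mod_cast hs.ne'
  set w : ℂ := (I * s)⁻¹ with hw
  have hwim : w.im = -s⁻¹ := by
    rw [hw, mul_inv, Complex.inv_I, ← Complex.ofReal_inv]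
    simp
  have hlow : ∀ t : ℝ, s⁻¹ ≤ ‖w - t‖ := by
    intro t
    have := Complex.abs_im_le_norm (w - t)
    rw [Complex.sub_im, hwim, Complex.ofReal_im, sub_zero, abs_neg,
      abs_of_pos (by positivity)] at this
    exact this
  have hint : ∀ (ν : Measure ℝ) [IsProbabilityMeasure ν],
      Integrable (fun t : ℝ => (w - (t : ℂ))⁻¹) ν := fun ν _ =>
    Integrable.of_bound (Measurable.aestronglyMeasurable (by fun_prop)) s
      (Eventually.of_forall fun t => by
        rw [norm_inv]
        exact inv_le_of_inv_le₀ hs (hlow t))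
  have hint' : Integrable (fun t : ℝ => (w - ((-t : ℝ) : ℂ))⁻¹) μ :=
    (hint (μ.map fun x => -x)).comp_measurable hm
  rw [cauchyT, symmetrization, integral_smul_measure, integral_add_measure (hint μ) (hint _),
    integral_map hm.aemeasurable (Measurable.aestronglyMeasurable (by fun_prop)),
    ← integral_add (hint μ) hint', ← integral_complex_ofReal, ← integral_const_mul,
    ← integral_smul]
  refine integral_congr_ae (Eventually.of_forall fun t => ?_)
  have h1 : w - t ≠ 0 := norm_pos_iff.1 (lt_of_lt_of_le (by positivity) (hlow t))
  have h2 : w - ((-t : ℝ) : ℂ) ≠ 0 := norm_pos_iff.1 (lt_of_lt_of_le (by positivity) (hlow (-t)))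
  have h3 : (1 + (s : ℂ) ^ 2 * (t : ℂ) ^ 2) ≠ 0 := by
    exact_mod_cast (by positivity : 1 + s ^ 2 * t ^ 2 ≠ 0)
  have hws : w * (I * s) = 1 := by
    rw [hw]; exact inv_mul_cancel₀ (mul_ne_zero Complex.I_ne_zero hs')
  clear_value w
  have hprod : (w - t) * (w - ((-t : ℝ) : ℂ)) * (I * s) = w * (1 + (s : ℂ) ^ 2 * (t : ℂ) ^ 2) := by
    push_cast
    linear_combination (w + (t : ℂ) ^ 2 * I * s) * hws - w * s ^ 2 * t ^ 2 * Complex.I_sq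
  dsimp only
  rw [ENNReal.toReal_inv, ENNReal.toReal_ofNat, Complex.real_smul]
  push_cast at h2 hprod ⊢
  rw [inv_add_inv h1 h2, show w - t + (w - -(t : ℂ)) = 2 * w by ring]
  rw [← div_eq_mul_inv, show (2 : ℂ)⁻¹ * (2 * w / ((w - t) * (w - -(t : ℂ)))) =
    w / ((w - t) * (w - -(t : ℂ))) by ring, div_eq_div_iff (mul_ne_zero h1 h2) h3]
  linear_combination -hprod

/-- For small `ξ > 0` and `m = 1 - ξ S(ξ)`, the number `m` is the limit of the iteration at the
point `s` with `s² = ξ / T(m - 1)`. -/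
lemma exists_forall_tendsto_realStep_iterate {l : ℝ} (hl : l ∈ Icc (0 : ℝ) 1) (G : Measure ℝ)
    [IsFiniteMeasure G] :
    ∃ β > 0, ∀ ξ, 0 < ξ → ξ < β → ∃ s > 0, s ^ 2 ≤ 2 * ξ ∧
      0 < (l * (1 - ξ * realS G ξ) + (1 - l)) * (1 - ξ * realS G ξ) ∧
      s ^ 2 * ((l * (1 - ξ * realS G ξ) + (1 - l)) * (1 - ξ * realS G ξ)) = ξ ∧
      Tendsto (fun n => (realStep l G s)^[n] 1) atTop (nhds (1 - ξ * realS G ξ)) := by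
  have hev := (tendsto_mul_realS G).eventually (Iio_mem_nhds (by norm_num : (0 : ℝ) < 1 / 32))
  obtain ⟨β, hβ, hsmall⟩ := mem_nhdsGT_iff_exists_Ioo_subset.1 hev
  refine ⟨β / 2, half_pos hβ, fun ξ hξ hξβ => ?_⟩
  have he1 : ξ * realS G ξ < 1 / 32 := hsmall ⟨hξ, by linarith [show 0 < β from hβ]⟩
  have he0 : 0 ≤ ξ * realS G ξ := mul_nonneg hξ.le (realS_nonneg G hξ.le)
  set e := ξ * realS G ξ with he
  set m := 1 - e with hm
  set B := l * m + (1 - l) with hB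
  have hm1 : 31 / 32 ≤ m := by linarith
  have hB1 : 31 / 32 ≤ B := by nlinarith [hl.1, hl.2]
  have hBm : 1 / 2 ≤ B * m := by nlinarith
  have hs2 : √(ξ / (B * m)) ^ 2 = ξ / (B * m) := Real.sq_sqrt (by positivity)
  have hle : ξ / (B * m) ≤ 2 * ξ := by
    rw [div_le_iff₀ (by positivity)]
    nlinarith
  have hpos : 0 < ξ / (B * m) := by positivity
  refine ⟨√(ξ / (B * m)), Real.sqrt_pos.2 hpos, hs2.le.trans hle, by positivity, ?_, ?_⟩
  · rw [hs2]; field_simp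
  · refine tendsto_realStep_iterate hl G (Real.sqrt_pos.2 hpos) ?_
      ⟨by linarith, by linarith⟩ ?_
    · rw [hs2]
      have : ξ / (B * m) * realS G (ξ / (B * m)) < 1 / 32 := hsmall ⟨hpos, by linarith⟩
      linarith
    · rw [realStep, hs2, ← hB, show ξ / (B * m) * (m * B) = ξ by field_simp,
        show 1 + ξ / (B * m) * B * realS G ξ = (m + e) / m by rw [he]; field_simp,
        show m + e = 1 by rw [hm]; ring, one_div, inv_inv]

/-- every symmetric positive finite measure `G` on `ℝ` is the Lévy measure of a
`⊞_λ`-infinitely divisible distribution: there are a symmetric probability measure `μ` and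
`β > 0` such that for all `x ∈ (-β, 0)`, `T(C^{(G)}(x)) ≠ 0`, `x / T(C^{(G)}(x)) ∈ ℂ ∖ [0,∞)`,
and `H_μ(x / T(C^{(G)}(x))) = x`, i.e. the rectangular `R`-transform of `μ` is `C^{(G)}`. -/
theorem stmt4 (l : ℝ) (hl : l ∈ Set.Icc (0:ℝ) 1)
    (G : Measure ℝ) [IsFiniteMeasure G] (hGsym : G.map (fun x => -x) = G) :
    ∃ μ : Measure ℝ, IsProbabilityMeasure μ ∧ μ.map (fun x => -x) = μ ∧
      ∃ β : ℝ, 0 < β ∧ ∀ x : ℝ, -β < x → x < 0 →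
        Tpoly l (Cmeas G (x:ℂ)) ≠ 0 ∧
        ¬((((x:ℂ) / Tpoly l (Cmeas G (x:ℂ))).im = 0) ∧
            0 ≤ ((x:ℂ) / Tpoly l (Cmeas G (x:ℂ))).re) ∧
        Hfun l μ ((x:ℂ) / Tpoly l (Cmeas G (x:ℂ))) = (x:ℂ) := by
  obtain ⟨β, hβ, hstep⟩ := exists_forall_tendsto_realStep_iterate hl G
  obtain ⟨σ, hσ⟩ := exists_finiteMeasure_limit hl G
  have hξ : Tendsto (fun k : ℕ => β * (1 / ((k : ℝ) + 1)) / 2) atTop (nhds 0) := by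
    simpa using (tendsto_one_div_add_atTop_nhds_zero_nat.const_mul β).div_const 2
  have hξpos : ∀ k : ℕ, 0 < β * (1 / ((k : ℝ) + 1)) / 2 := fun k => by positivity
  have hξlt : ∀ k : ℕ, β * (1 / ((k : ℝ) + 1)) / 2 < β := fun k => by
    have : 1 / ((k : ℝ) + 1) ≤ 1 := by
      rw [div_le_one (by positivity)]
      linarith [(Nat.cast_nonneg k : (0 : ℝ) ≤ k)]
    nlinarith
  choose s hs hs2 _ _ hslim using fun k => hstep _ (hξpos k) (hξlt k)
  have hs0 : Tendsto s atTop (nhds 0) := by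
    have h2 : Tendsto (fun k => s k ^ 2) atTop (nhds 0) :=
      squeeze_zero (fun k => by positivity) hs2 (by simpa using hξ.const_mul 2)
    have h3 := (Real.continuous_sqrt.tendsto 0).comp h2
    rw [Real.sqrt_zero] at h3
    exact h3.congr fun k => Real.sqrt_sq (hs k).le
  have hm1 := ((tendsto_mul_realS G).comp (tendsto_nhdsWithin_iff.2
    ⟨hξ, Eventually.of_forall hξpos⟩)).const_sub 1
  rw [sub_zero] at hm1
  obtain ⟨μ, hμ, hμint⟩ := exists_isProbabilityMeasure_of_tendsto σ hs hs0 hm1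
    fun k => hσ _ _ (hs k) (hslim k)
  refine ⟨symmetrization μ, isProbabilityMeasure_symmetrization μ, map_neg_symmetrization μ, β, hβ,
    fun x hx1 hx2 => ?_⟩
  obtain ⟨r, hr, -, hT, hrT, hlim⟩ := hstep (-x) (by linarith) (by linarith)
  set m := 1 - -x * realS G (-x) with hm
  have hC : Cmeas G (x : ℂ) = ((m - 1 : ℝ) : ℂ) := by
    have : levyS G (x : ℂ) = (realS G (-x) : ℂ) := by
      rw [← levyS_neg_ofReal, Complex.ofReal_neg, neg_neg]
    change (x : ℂ) * levyS G x = _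
    rw [this, hm]
    push_cast
    ring
  have hTp : Tpoly l (Cmeas G (x : ℂ)) = (((l * m + (1 - l)) * m : ℝ) : ℂ) := by
    rw [hC, Tpoly]
    push_cast
    ring
  have hz : (x : ℂ) / Tpoly l (Cmeas G (x : ℂ)) = ((-(r ^ 2) : ℝ) : ℂ) := by
    rw [hTp, ← Complex.ofReal_div]
    congr 1
    rw [div_eq_iff hT.ne']
    linarith
  refine ⟨?_, ?_, ?_⟩
  · rw [hTp]
    exact_mod_cast hT.ne'
  · rw [hz, Complex.ofReal_re]
    rintro ⟨-, h⟩
    nlinarith [pow_pos hr 2]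
  · rw [hz, Hfun, sqrtCut_neg_sq hr.le, cauchyT_symmetrization μ hr, hμint r hr, hσ r m hr hlim]
    have hx : (x : ℂ) = -((r ^ 2 * ((l * m + (1 - l)) * m) : ℝ) : ℂ) := by
      rw [hrT]
      simp
    rw [hx]
    push_cast
    linear_combination ((l : ℂ) * (r * m) ^ 2 + (1 - l) * r ^ 2 * m) * Complex.I_sq
end

section
/- For every n ≥ 1 there exists a bijection Φ from the set of noncrossing partitions of {1,…,n} onto the set of noncrossing pairings of {1,…,2n} such that for every noncrossing partition π of {1,…,n}, the number of blocks of π equals o(Φ(π)), the number of blocks of Φ(π) whose minimum is odd. -/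
open Finset

/-- `P` is a set partition of the finite set `s ⊆ ℕ`, encoded as a finite set of blocks. -/
def IsPartitionOf (s : Finset ℕ) (P : Finset (Finset ℕ)) : Prop :=
  (∀ B ∈ P, B ⊆ s) ∧ (∀ B ∈ P, B.Nonempty) ∧ (∀ x ∈ s, ∃ B ∈ P, x ∈ B) ∧
  (∀ B ∈ P, ∀ C ∈ P, ∀ x ∈ B, x ∈ C → B = C)

/-- A partition is noncrossing if there are no `i < j < k < l` with `i, k` in one block and
`j, l` in a different block. -/
def IsNoncrossing (P : Finset (Finset ℕ)) : Prop :=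
  ¬ ∃ B ∈ P, ∃ C ∈ P, B ≠ C ∧
      ∃ i ∈ B, ∃ j ∈ C, ∃ k ∈ B, ∃ l ∈ C, i < j ∧ j < k ∧ k < l

/-- A pairing is a partition all of whose blocks have exactly two elements. -/
def IsPairing (P : Finset (Finset ℕ)) : Prop := ∀ B ∈ P, B.card = 2

/-- `m` is the minimum of the block `B` and is odd. -/
def oddMin (B : Finset ℕ) : Prop := ∃ m ∈ B, Odd m ∧ ∀ x ∈ B, m ≤ x

instance : DecidablePred oddMin := fun B => by unfold oddMin; infer_instance

/-- `o(P)`: the number of blocks of `P` whose minimal element is odd. -/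
def oCount (P : Finset (Finset ℕ)) : ℕ := (P.filter oddMin).card

/-- The arc joining the left copy `2 * a - 1` of the minimum `a` of `B` to the right copy `2 * b` of
its maximum `b`. -/
def IsOuterArc (B S : Finset ℕ) : Prop :=
  ∃ a ∈ B, ∃ b ∈ B, (∀ c ∈ B, a ≤ c ∧ c ≤ b) ∧ S = {2 * a - 1, 2 * b}

/-- An arc joining the right copy `2 * a` of an element of `B` to the left copy `2 * b - 1` of
the next element of `B`. -/
def IsInnerArc (B S : Finset ℕ) : Prop :=
  ∃ a ∈ B, ∃ b ∈ B, a < b ∧ (∀ c ∈ B, c ≤ a ∨ b ≤ c) ∧ S = {2 * a, 2 * b - 1}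

open Classical in
/-- The pairing of `{1,…,2n}` obtained by doubling each point of `{1,…,n}` and tracing the
outlines of the blocks of `P`. -/
noncomputable def fattening (n : ℕ) (P : Finset (Finset ℕ)) : Finset (Finset ℕ) :=
  (Finset.Icc 1 (2 * n)).powerset.filter fun S => ∃ B ∈ P, IsOuterArc B S ∨ IsInnerArc B S

lemma IsPartitionOf.bounds {n : ℕ} {P : Finset (Finset ℕ)}
    (hP : IsPartitionOf (Finset.Icc 1 n) P) {B : Finset ℕ} (hB : B ∈ P) {x : ℕ} (hx : x ∈ B) :
    1 ≤ x ∧ x ≤ n :=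
  Finset.mem_Icc.1 (hP.1 B hB hx)

lemma IsPartitionOf.eq_of_subset {s : Finset ℕ} {P Q : Finset (Finset ℕ)}
    (hP : IsPartitionOf s P) (hQ : IsPartitionOf s Q) (h : P ⊆ Q) : P = Q := by
  refine h.antisymm fun C hC => ?_
  obtain ⟨x, hx⟩ := hQ.2.1 C hC
  obtain ⟨B, hB, hxB⟩ := hP.2.2.1 x (hQ.1 C hC hx)
  rwa [hQ.2.2.2 C hC B (h hB) x hx hxB]

lemma mem_fattening {n : ℕ} {P : Finset (Finset ℕ)} (hP : IsPartitionOf (Finset.Icc 1 n) P)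
    {S : Finset ℕ} : S ∈ fattening n P ↔ ∃ B ∈ P, IsOuterArc B S ∨ IsInnerArc B S := by
  classical
  rw [fattening, Finset.mem_filter, Finset.mem_powerset, and_iff_right_iff_imp]
  rintro ⟨B, hB, ⟨a, ha, b, hb, -, rfl⟩ | ⟨a, ha, b, hb, -, -, rfl⟩⟩ x hx <;>
  · have := hP.bounds hB ha
    have := hP.bounds hB hb
    simp only [Finset.mem_insert, Finset.mem_singleton] at hx
    rw [Finset.mem_Icc]
    omega

lemma exists_isOuterArc {B : Finset ℕ} (hB : B.Nonempty) : ∃ S, IsOuterArc B S :=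
  ⟨_, _, B.min'_mem hB, _, B.max'_mem hB, fun c hc => ⟨B.min'_le c hc, B.le_max' c hc⟩, rfl⟩

lemma exists_pred_mem {B : Finset ℕ} {i j : ℕ} (hi : i ∈ B) (hij : i < j) :
    ∃ p ∈ B, i ≤ p ∧ p < j ∧ ∀ c ∈ B, c ≤ p ∨ j ≤ c := by
  have hne : (B.filter (· < j)).Nonempty := ⟨i, by simp [hi, hij]⟩
  have hmem := Finset.mem_filter.1 ((B.filter (· < j)).max'_mem hne)
  have hle : ∀ c ∈ B, c < j → c ≤ (B.filter (· < j)).max' hne := fun c hc hcj =>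
    Finset.le_max' _ c (by simp [hc, hcj])
  refine ⟨_, hmem.1, hle i hi hij, hmem.2, fun c hc => ?_⟩
  by_cases h : c < j
  · exact Or.inl (hle c hc h)
  · exact Or.inr (not_lt.1 h)

lemma exists_succ_mem {B : Finset ℕ} {i j : ℕ} (hj : j ∈ B) (hij : i < j) :
    ∃ q ∈ B, i < q ∧ ∀ c ∈ B, c ≤ i ∨ q ≤ c := by
  have hne : (B.filter (i < ·)).Nonempty := ⟨j, by simp [hj, hij]⟩
  have hmem := Finset.mem_filter.1 ((B.filter (i < ·)).min'_mem hne)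
  refine ⟨_, hmem.1, hmem.2, fun c hc => ?_⟩
  by_cases h : i < c
  · exact Or.inr (Finset.min'_le _ c (by simp [hc, h]))
  · exact Or.inl (not_lt.1 h)

lemma exists_arc_right {B : Finset ℕ} {i : ℕ} (hi : i ∈ B) :
    ∃ S, (IsOuterArc B S ∨ IsInnerArc B S) ∧ 2 * i ∈ S := by
  by_cases h : ∃ j ∈ B, i < j
  · obtain ⟨j, hj, hij⟩ := h
    obtain ⟨q, hq, hiq, hc⟩ := exists_succ_mem hj hij
    exact ⟨_, Or.inr ⟨i, hi, q, hq, hiq, hc, rfl⟩, by simp⟩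
  · push Not at h
    exact ⟨_, Or.inl ⟨_, B.min'_mem ⟨i, hi⟩, i, hi, fun c hc => ⟨B.min'_le c hc, h c hc⟩, rfl⟩,
      by simp⟩

lemma exists_arc_left {B : Finset ℕ} {i : ℕ} (hi : i ∈ B) :
    ∃ S, (IsOuterArc B S ∨ IsInnerArc B S) ∧ 2 * i - 1 ∈ S := by
  by_cases h : ∃ j ∈ B, j < i
  · obtain ⟨j, hj, hji⟩ := h
    obtain ⟨p, hp, -, hpi, hc⟩ := exists_pred_mem hj hji
    exact ⟨_, Or.inr ⟨p, hp, i, hi, hpi, hc, rfl⟩, by simp⟩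
  · push Not at h
    exact ⟨_, Or.inl ⟨i, hi, _, B.max'_mem ⟨i, hi⟩, fun c hc => ⟨h c hc, B.le_max' c hc⟩, rfl⟩,
      by simp⟩

/-- Each endpoint of an arc of `B` is a copy of the element `(x + 1) / 2` of `B`. -/
lemma half_mem_of_mem_arc {B S : Finset ℕ} (hpos : ∀ c ∈ B, 1 ≤ c)
    (hS : IsOuterArc B S ∨ IsInnerArc B S) {x : ℕ} (hx : x ∈ S) : (x + 1) / 2 ∈ B := by
  obtain ⟨a, ha, b, hb, -, rfl⟩ | ⟨a, ha, b, hb, -, -, rfl⟩ := hS <;>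
  · have := hpos a ha
    have := hpos b hb
    simp only [Finset.mem_insert, Finset.mem_singleton] at hx
    obtain rfl | rfl := hx
    · convert ha using 1
      omega
    · convert hb using 1
      omega

lemma arc_eq_of_mem {B S T : Finset ℕ} (hpos : ∀ c ∈ B, 1 ≤ c)
    (hS : IsOuterArc B S ∨ IsInnerArc B S) (hT : IsOuterArc B T ∨ IsInnerArc B T) {x : ℕ}
    (hxS : x ∈ S) (hxT : x ∈ T) : S = T := by
  obtain ⟨a, ha, b, hb, h, rfl⟩ | ⟨a, ha, b, hb, hab, h, rfl⟩ := hS <;>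
  obtain ⟨a', ha', b', hb', h', rfl⟩ | ⟨a', ha', b', hb', hab', h', rfl⟩ := hT <;>
  · have := hpos a ha
    have := hpos b hb
    have := hpos a' ha'
    have := hpos b' hb'
    have := h a' ha'
    have := h b' hb'
    have := h' a ha
    have := h' b hb
    simp only [Finset.mem_insert, Finset.mem_singleton] at hxS hxT
    first
    | exfalso; omega
    | have haa : a = a' := by omega
      have hbb : b = b' := by omega
      rw [haa, hbb]

lemma arcs_not_crossing {B S T : Finset ℕ} (hpos : ∀ c ∈ B, 1 ≤ c)
    (hS : IsOuterArc B S ∨ IsInnerArc B S) (hT : IsOuterArc B T ∨ IsInnerArc B T) {i j k l : ℕ}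
    (hi : i ∈ S) (hj : j ∈ T) (hk : k ∈ S) (hl : l ∈ T) (hij : i < j) (hjk : j < k)
    (hkl : k < l) : False := by
  obtain ⟨a, ha, b, hb, h, rfl⟩ | ⟨a, ha, b, hb, hab, h, rfl⟩ := hS <;>
  obtain ⟨a', ha', b', hb', h', rfl⟩ | ⟨a', ha', b', hb', hab', h', rfl⟩ := hT <;>
  · have := hpos a ha
    have := hpos b hb
    have := hpos a' ha'
    have := hpos b' hb'
    have := h a' ha'
    have := h b' hb'
    have := h' a ha
    have := h' b hb
    simp only [Finset.mem_insert, Finset.mem_singleton] at hi hj hk hl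
    omega

lemma fattening_isPartitionOf {n : ℕ} {P : Finset (Finset ℕ)}
    (hP : IsPartitionOf (Finset.Icc 1 n) P) :
    IsPartitionOf (Finset.Icc 1 (2 * n)) (fattening n P) := by
  classical
  refine ⟨fun S hS => Finset.mem_powerset.1 (Finset.mem_filter.1 hS).1, ?_, ?_, ?_⟩
  · intro S hS
    obtain ⟨B, -, ⟨a, -, b, -, -, rfl⟩ | ⟨a, -, b, -, -, -, rfl⟩⟩ := (mem_fattening hP).1 hS <;>
    exact Finset.insert_nonempty _ _
  · intro x hx
    rw [Finset.mem_Icc] at hx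
    obtain ⟨B, hB, hxB⟩ := hP.2.2.1 ((x + 1) / 2) (Finset.mem_Icc.2 (by omega))
    obtain hpar | hpar : x = 2 * ((x + 1) / 2) ∨ x = 2 * ((x + 1) / 2) - 1 := by omega
    · obtain ⟨S, hS, hxS⟩ := exists_arc_right hxB
      exact ⟨S, (mem_fattening hP).2 ⟨B, hB, hS⟩, hpar ▸ hxS⟩
    · obtain ⟨S, hS, hxS⟩ := exists_arc_left hxB
      exact ⟨S, (mem_fattening hP).2 ⟨B, hB, hS⟩, hpar ▸ hxS⟩
  · intro S hS T hT x hxS hxT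
    obtain ⟨B, hB, hBS⟩ := (mem_fattening hP).1 hS
    obtain ⟨C, hC, hCT⟩ := (mem_fattening hP).1 hT
    have hposB : ∀ c ∈ B, 1 ≤ c := fun c hc => (hP.bounds hB hc).1
    have hposC : ∀ c ∈ C, 1 ≤ c := fun c hc => (hP.bounds hC hc).1
    obtain rfl := hP.2.2.2 B hB C hC _ (half_mem_of_mem_arc hposB hBS hxS)
      (half_mem_of_mem_arc hposC hCT hxT)
    exact arc_eq_of_mem hposB hBS hCT hxS hxT

lemma fattening_isPairing {n : ℕ} {P : Finset (Finset ℕ)}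
    (hP : IsPartitionOf (Finset.Icc 1 n) P) : IsPairing (fattening n P) := by
  intro S hS
  obtain ⟨B, hB, ⟨a, ha, b, hb, -, rfl⟩ | ⟨a, ha, b, hb, -, -, rfl⟩⟩ :=
    (mem_fattening hP).1 hS <;>
  · have := hP.bounds hB ha
    have := hP.bounds hB hb
    exact Finset.card_pair (by omega)

lemma fattening_isNoncrossing {n : ℕ} {P : Finset (Finset ℕ)}
    (hP : IsPartitionOf (Finset.Icc 1 n) P) (hnc : IsNoncrossing P) :
    IsNoncrossing (fattening n P) := by
  rintro ⟨S, hS, T, hT, -, i, hi, j, hj, k, hk, l, hl, hij, hjk, hkl⟩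
  obtain ⟨B, hB, hBS⟩ := (mem_fattening hP).1 hS
  obtain ⟨C, hC, hCT⟩ := (mem_fattening hP).1 hT
  have hposB : ∀ c ∈ B, 1 ≤ c := fun c hc => (hP.bounds hB hc).1
  have hposC : ∀ c ∈ C, 1 ≤ c := fun c hc => (hP.bounds hC hc).1
  by_cases hBC : B = C
  · subst hBC
    exact arcs_not_crossing hposB hBS hCT hi hj hk hl hij hjk hkl
  · have hne : ∀ x ∈ S, ∀ y ∈ T, (x + 1) / 2 ≠ (y + 1) / 2 := fun x hx y hy hxy =>
      hBC (hP.2.2.2 B hB C hC _ (half_mem_of_mem_arc hposB hBS hx)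
        (hxy ▸ half_mem_of_mem_arc hposC hCT hy))
    have := hne i hi j hj
    have := hne k hk j hj
    have := hne k hk l hl
    exact hnc ⟨B, hB, C, hC, hBC, _, half_mem_of_mem_arc hposB hBS hi,
      _, half_mem_of_mem_arc hposC hCT hj, _, half_mem_of_mem_arc hposB hBS hk,
      _, half_mem_of_mem_arc hposC hCT hl, by omega, by omega, by omega⟩

lemma oddMin_of_isOuterArc {B S : Finset ℕ} (hpos : ∀ c ∈ B, 1 ≤ c) (h : IsOuterArc B S) :
    oddMin S := by
  obtain ⟨a, ha, b, hb, hab, rfl⟩ := h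
  have := hpos a ha
  have := hab b hb
  refine ⟨2 * a - 1, by simp, ⟨a - 1, by omega⟩, fun x hx => ?_⟩
  simp only [Finset.mem_insert, Finset.mem_singleton] at hx
  omega

lemma not_oddMin_of_isInnerArc {B S : Finset ℕ} (h : IsInnerArc B S) : ¬ oddMin S := by
  obtain ⟨a, ha, b, hb, hab, -, rfl⟩ := h
  rintro ⟨m, hm, ⟨r, hr⟩, hmin⟩
  have := hmin (2 * a) (by simp)
  simp only [Finset.mem_insert, Finset.mem_singleton] at hm
  omega

lemma oCount_fattening {n : ℕ} {P : Finset (Finset ℕ)}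
    (hP : IsPartitionOf (Finset.Icc 1 n) P) : oCount (fattening n P) = P.card := by
  have hpos : ∀ B ∈ P, ∀ c ∈ B, 1 ≤ c := fun B hB c hc => (hP.bounds hB hc).1
  choose outer houter using fun B (hB : B ∈ P) => exists_isOuterArc (hP.2.1 B hB)
  refine (Finset.card_bij outer ?_ ?_ ?_).symm
  · intro B hB
    exact Finset.mem_filter.2 ⟨(mem_fattening hP).2 ⟨B, hB, Or.inl (houter B hB)⟩,
      oddMin_of_isOuterArc (hpos B hB) (houter B hB)⟩
  · intro B hB C hC hBC
    have hC' := houter C hC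
    rw [← hBC] at hC'
    have hx : ∃ x, x ∈ outer B hB := by
      obtain ⟨a, -, b, -, -, h⟩ := houter B hB
      exact ⟨2 * b, by simp [h]⟩
    obtain ⟨x, hx⟩ := hx
    exact hP.2.2.2 B hB C hC _ (half_mem_of_mem_arc (hpos B hB) (Or.inl (houter B hB)) hx)
      (half_mem_of_mem_arc (hpos C hC) (Or.inl hC') hx)
  · intro S hS
    obtain ⟨hS, hodd⟩ := Finset.mem_filter.1 hS
    obtain ⟨B, hB, hout | hin⟩ := (mem_fattening hP).1 hS
    · obtain ⟨a, ha, b, hb, h, rfl⟩ := hout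
      obtain ⟨a', ha', b', hb', h', heq⟩ := houter B hB
      have haa : a = a' := le_antisymm (h a' ha').1 (h' a ha).1
      have hbb : b = b' := le_antisymm (h' b hb).2 (h b' hb').2
      exact ⟨B, hB, by rw [heq, haa, hbb]⟩
    · exact absurd hodd (not_oddMin_of_isInnerArc hin)

/-- A pair `{2 * i, 2 * j - 1}` of the fattening of `P` records that `i` and `j` share a block. -/
lemma same_block_of_pair_mem_fattening {n : ℕ} {P : Finset (Finset ℕ)}
    (hP : IsPartitionOf (Finset.Icc 1 n) P) {i j : ℕ} (hj1 : 1 ≤ j)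
    (h : {2 * i, 2 * j - 1} ∈ fattening n P) {B : Finset ℕ} (hB : B ∈ P) : i ∈ B ↔ j ∈ B := by
  obtain ⟨C, hC, harc⟩ := (mem_fattening hP).1 h
  have hposC : ∀ c ∈ C, 1 ≤ c := fun c hc => (hP.bounds hC hc).1
  have hi : i ∈ C := by
    convert half_mem_of_mem_arc hposC harc (x := 2 * i) (by simp) using 1
    omega
  have hj : j ∈ C := by
    convert half_mem_of_mem_arc hposC harc (x := 2 * j - 1) (by simp) using 1
    omega
  exact ⟨fun h => hP.2.2.2 B hB C hC i h hi ▸ hj, fun h => hP.2.2.2 B hB C hC j h hj ▸ hi⟩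

lemma block_subset_of_fattening_eq {n : ℕ} {P P' : Finset (Finset ℕ)}
    (hP : IsPartitionOf (Finset.Icc 1 n) P) (hP' : IsPartitionOf (Finset.Icc 1 n) P')
    (h : fattening n P = fattening n P') {B B' : Finset ℕ} (hB : B ∈ P) (hB' : B' ∈ P') {x : ℕ}
    (hx : x ∈ B) (hx' : x ∈ B') : B ⊆ B' := by
  have key : ∀ j ∈ B, ∀ i ∈ B, i < j → (i ∈ B' ↔ j ∈ B') := by
    intro j
    induction j using Nat.strong_induction_on with
    | _ j ih =>
      intro hj i hi hij
      obtain ⟨p, hp, hip, hpj, hc⟩ := exists_pred_mem hi hij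
      have hpj' : p ∈ B' ↔ j ∈ B' := by
        refine same_block_of_pair_mem_fattening hP' (hP.bounds hB hj).1 ?_ hB'
        rw [← h]
        exact (mem_fattening hP).2 ⟨B, hB, Or.inr ⟨p, hp, j, hj, hpj, hc, rfl⟩⟩
      obtain rfl | hlt := hip.eq_or_lt
      · exact hpj'
      · exact (ih p hpj hp i hi hlt).trans hpj'
  intro y hy
  obtain hlt | rfl | hlt := lt_trichotomy x y
  · exact (key y hy x hx hlt).1 hx'
  · exact hx'
  · exact (key x hx y hy hlt).2 hx'

lemma fattening_injOn {n : ℕ} {P P' : Finset (Finset ℕ)}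
    (hP : IsPartitionOf (Finset.Icc 1 n) P) (hP' : IsPartitionOf (Finset.Icc 1 n) P')
    (h : fattening n P = fattening n P') : P = P' := by
  refine hP.eq_of_subset hP' fun B hB => ?_
  obtain ⟨x, hx⟩ := hP.2.1 B hB
  obtain ⟨B', hB', hx'⟩ := hP'.2.2.1 x (hP.1 B hB hx)
  rwa [(block_subset_of_fattening_eq hP hP' h hB hB' hx hx').antisymm
    (block_subset_of_fattening_eq hP' hP h.symm hB' hB hx' hx)]

/-- The relation putting `b` directly after `a` in a block of the partition obtained from the
pairing `Q`. -/
def Link (Q : Finset (Finset ℕ)) (a b : ℕ) : Prop :=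
  1 ≤ a ∧ a < b ∧ {2 * a, 2 * b - 1} ∈ Q

/-- `a` and `b` lie on a common chain of links. -/
def Linked (Q : Finset (Finset ℕ)) (a b : ℕ) : Prop :=
  Relation.ReflTransGen (Link Q) a b ∨ Relation.ReflTransGen (Link Q) b a

open Classical in
/-- The partition of `{1,…,n}` into chains of links of the pairing `Q`. -/
noncomputable def thinning (n : ℕ) (Q : Finset (Finset ℕ)) : Finset (Finset ℕ) :=
  (Finset.Icc 1 n).image fun i => (Finset.Icc 1 n).filter (Linked Q i)

lemma pair_partner_unique {s : Finset ℕ} {Q : Finset (Finset ℕ)} (hQ : IsPartitionOf s Q)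
    (hpair : IsPairing Q) {x y z : ℕ} (hy : {x, y} ∈ Q) (hz : {x, z} ∈ Q) : y = z := by
  have heq : ({x, y} : Finset ℕ) = {x, z} := hQ.2.2.2 _ hy _ hz x (by simp) (by simp)
  have hxy : x ≠ y := by
    rintro rfl
    simpa using hpair _ hy
  have hmem : y ∈ ({x, z} : Finset ℕ) := heq ▸ by simp
  simp only [Finset.mem_insert, Finset.mem_singleton] at hmem
  exact hmem.resolve_left hxy.symm

lemma exists_partner {s : Finset ℕ} {Q : Finset (Finset ℕ)} (hQ : IsPartitionOf s Q)
    (hpair : IsPairing Q) {x : ℕ} (hx : x ∈ s) : ∃ y ∈ s, y ≠ x ∧ {x, y} ∈ Q := by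
  obtain ⟨S, hS, hxS⟩ := hQ.2.2.1 x hx
  obtain ⟨u, v, huv, rfl⟩ := Finset.card_eq_two.1 (hpair S hS)
  simp only [Finset.mem_insert, Finset.mem_singleton] at hxS
  obtain rfl | rfl := hxS
  · exact ⟨v, hQ.1 _ hS (by simp), huv.symm, hS⟩
  · exact ⟨u, hQ.1 _ hS (by simp), huv, by rwa [Finset.pair_comm]⟩

lemma pairs_not_crossing {Q : Finset (Finset ℕ)} (hnc : IsNoncrossing Q) {x y z w : ℕ}
    (hxz : {x, z} ∈ Q) (hyw : {y, w} ∈ Q) (hxy : x < y) (hyz : y < z) (hzw : z < w) : False := by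
  refine hnc ⟨_, hxz, _, hyw, fun heq => ?_, x, by simp, y, by simp, z, by simp, w, by simp,
    hxy, hyz, hzw⟩
  have hmem : x ∈ ({y, w} : Finset ℕ) := heq ▸ by simp
  simp only [Finset.mem_insert, Finset.mem_singleton] at hmem
  omega

lemma card_even_of_isPairing {s : Finset ℕ} {Q : Finset (Finset ℕ)} (hQ : IsPartitionOf s Q)
    (hpair : IsPairing Q) : Even s.card := by
  have hs : Q.biUnion id = s := by
    ext x
    simp only [Finset.mem_biUnion, id]
    exact ⟨fun ⟨S, hS, hx⟩ => hQ.1 S hS hx, hQ.2.2.1 x⟩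
  rw [← hs, Finset.card_biUnion]
  · exact Finset.even_sum _ fun S hS => (hpair S hS).symm ▸ even_two
  · intro S hS T hT hne
    exact Finset.disjoint_left.2 fun x hxS hxT => hne (hQ.2.2.2 S hS T hT x hxS hxT)

/-- In a noncrossing pairing of an interval, paired points have opposite parity. -/
lemma odd_sub_of_pair_mem {m : ℕ} {Q : Finset (Finset ℕ)}
    (hQ : IsPartitionOf (Finset.Icc 1 m) Q) (hpair : IsPairing Q) (hnc : IsNoncrossing Q)
    {x y : ℕ} (hxy : x < y) (h : {x, y} ∈ Q) : Odd (y - x) := by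
  have hx := Finset.mem_Icc.1 (hQ.1 _ h (show x ∈ _ by simp))
  have hy := Finset.mem_Icc.1 (hQ.1 _ h (show y ∈ _ by simp))
  have hinner : IsPartitionOf (Finset.Ioo x y) (Q.filter (· ⊆ Finset.Ioo x y)) := by
    refine ⟨fun S hS => (Finset.mem_filter.1 hS).2,
      fun S hS => hQ.2.1 S (Finset.mem_filter.1 hS).1, fun z hz => ?_,
      fun S hS T hT => hQ.2.2.2 S (Finset.mem_filter.1 hS).1 T (Finset.mem_filter.1 hT).1⟩
    rw [Finset.mem_Ioo] at hz
    obtain ⟨w, hw, hwz, hzw⟩ := exists_partner hQ hpair (Finset.mem_Icc.2 (by omega) :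
      z ∈ Finset.Icc 1 m)
    have hwx : w ≠ x := by
      rintro rfl
      rw [Finset.pair_comm] at hzw
      have := pair_partner_unique hQ hpair h hzw
      omega
    have hwy : w ≠ y := by
      rintro rfl
      rw [Finset.pair_comm] at hzw h
      have := pair_partner_unique hQ hpair h hzw
      omega
    have hxw : x < w := by
      by_contra hlt
      rw [Finset.pair_comm] at hzw
      exact pairs_not_crossing hnc hzw h (by omega) hz.1 hz.2
    have hwy' : w < y := by
      by_contra hlt
      exact pairs_not_crossing hnc h hzw hz.1 hz.2 (by omega)
    refine ⟨_, Finset.mem_filter.2 ⟨hzw, ?_⟩, by simp⟩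
    simp only [Finset.insert_subset_iff, Finset.singleton_subset_iff, Finset.mem_Ioo]
    omega
  have heven := card_even_of_isPairing hinner fun S hS => hpair S (Finset.mem_filter.1 hS).1
  rw [Nat.card_Ioo] at heven
  obtain ⟨r, hr⟩ := heven
  exact ⟨r, by omega⟩

lemma link_rightUnique {s : Finset ℕ} {Q : Finset (Finset ℕ)} (hQ : IsPartitionOf s Q)
    (hpair : IsPairing Q) : Relator.RightUnique (Link Q) := by
  rintro a b c ⟨-, hab, h⟩ ⟨-, hac, h'⟩
  have := pair_partner_unique hQ hpair h h'
  omega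

lemma link_leftUnique {s : Finset ℕ} {Q : Finset (Finset ℕ)} (hQ : IsPartitionOf s Q)
    (hpair : IsPairing Q) : Relator.RightUnique (Function.swap (Link Q)) := by
  rintro a b c ⟨-, hab, h⟩ ⟨-, hac, h'⟩
  rw [Finset.pair_comm] at h h'
  have := pair_partner_unique hQ hpair h h'
  omega

lemma le_of_chain {Q : Finset (Finset ℕ)} {a b : ℕ}
    (h : Relation.ReflTransGen (Link Q) a b) : a ≤ b := by
  induction h with
  | refl => rfl
  | tail _ hl ih => exact ih.trans hl.2.1.le

/-- A chain of links passing from `≤ t` to `> t` has a link that does so. -/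
lemma exists_link_over {Q : Finset (Finset ℕ)} {a b t : ℕ}
    (h : Relation.ReflTransGen (Link Q) a b) (hat : a ≤ t) (htb : t < b) :
    ∃ u v, Relation.ReflTransGen (Link Q) a u ∧ Link Q u v ∧
      Relation.ReflTransGen (Link Q) v b ∧ u ≤ t ∧ t < v := by
  induction h with
  | refl => omega
  | @tail c d hac hcd ih =>
    by_cases htc : t < c
    · obtain ⟨u, v, hau, huv, hvc, hut, htv⟩ := ih htc
      exact ⟨u, v, hau, huv, hvc.tail hcd, hut, htv⟩
    · exact ⟨c, d, hac, hcd, .refl, not_lt.1 htc, htb⟩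

lemma Linked.symm {Q : Finset (Finset ℕ)} {a b : ℕ} (h : Linked Q a b) : Linked Q b a :=
  Or.symm h

lemma Linked.trans {s : Finset ℕ} {Q : Finset (Finset ℕ)} (hQ : IsPartitionOf s Q)
    (hpair : IsPairing Q) {a b c : ℕ} (hab : Linked Q a b) (hbc : Linked Q b c) :
    Linked Q a c := by
  obtain hab | hab := hab <;> obtain hbc | hbc := hbc
  · exact Or.inl (hab.trans hbc)
  · obtain h | h := Relation.ReflTransGen.total_of_right_unique (link_leftUnique hQ hpair)
      (Relation.reflTransGen_swap.2 hab) (Relation.reflTransGen_swap.2 hbc)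
    · exact Or.inr (Relation.reflTransGen_swap.1 h)
    · exact Or.inl (Relation.reflTransGen_swap.1 h)
  · exact Relation.ReflTransGen.total_of_right_unique (link_rightUnique hQ hpair) hab hbc
  · exact Or.inr (hbc.trans hab)

lemma Linked.chain {Q : Finset (Finset ℕ)} {a b : ℕ} (h : Linked Q a b) (hab : a ≤ b) :
    Relation.ReflTransGen (Link Q) a b := by
  obtain h | h := h
  · exact h
  · rw [le_antisymm hab (le_of_chain h)]

lemma exists_of_mem_thinning {n : ℕ} {Q : Finset (Finset ℕ)} {B : Finset ℕ}
    (hB : B ∈ thinning n Q) :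
    ∃ i ∈ Finset.Icc 1 n, ∀ x, x ∈ B ↔ x ∈ Finset.Icc 1 n ∧ Linked Q i x := by
  classical
  obtain ⟨i, hi, rfl⟩ := Finset.mem_image.1 hB
  exact ⟨i, hi, fun x => Finset.mem_filter⟩

lemma mem_block_iff {n : ℕ} {s : Finset ℕ} {Q : Finset (Finset ℕ)} (hQ : IsPartitionOf s Q)
    (hpair : IsPairing Q) {B : Finset ℕ} (hB : B ∈ thinning n Q) {x : ℕ} (hx : x ∈ B) (y : ℕ) :
    y ∈ B ↔ y ∈ Finset.Icc 1 n ∧ Linked Q x y := by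
  obtain ⟨i, -, hmem⟩ := exists_of_mem_thinning hB
  have hix := ((hmem x).1 hx).2
  rw [hmem]
  exact and_congr_right fun _ =>
    ⟨fun h => hix.symm.trans hQ hpair h, fun h => hix.trans hQ hpair h⟩

lemma thinning_isPartitionOf {n : ℕ} {Q : Finset (Finset ℕ)}
    (hQ : IsPartitionOf (Finset.Icc 1 (2 * n)) Q) (hpair : IsPairing Q) :
    IsPartitionOf (Finset.Icc 1 n) (thinning n Q) := by
  classical
  refine ⟨?_, ?_, ?_, ?_⟩
  · intro B hB x hx
    obtain ⟨i, -, hmem⟩ := exists_of_mem_thinning hB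
    exact ((hmem x).1 hx).1
  · intro B hB
    obtain ⟨i, hi, hmem⟩ := exists_of_mem_thinning hB
    exact ⟨i, (hmem i).2 ⟨hi, Or.inl .refl⟩⟩
  · intro x hx
    exact ⟨_, Finset.mem_image_of_mem _ hx, Finset.mem_filter.2 ⟨hx, Or.inl .refl⟩⟩
  · intro B hB C hC x hxB hxC
    ext y
    rw [mem_block_iff hQ hpair hB hxB, mem_block_iff hQ hpair hC hxC]

lemma thinning_isNoncrossing {n : ℕ} {Q : Finset (Finset ℕ)}
    (hQ : IsPartitionOf (Finset.Icc 1 (2 * n)) Q) (hpair : IsPairing Q) (hnc : IsNoncrossing Q) :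
    IsNoncrossing (thinning n Q) := by
  have hP := thinning_isPartitionOf hQ hpair
  rintro ⟨B, hB, C, hC, hBC, i, hi, j, hj, k, hk, l, hl, hij, hjk, hkl⟩
  have hik := ((mem_block_iff hQ hpair hB hi k).1 hk).2.chain (by omega)
  have hjl := ((mem_block_iff hQ hpair hC hj l).1 hl).2.chain (by omega)
  obtain ⟨a, b, hia, hab, hbk, haj, hjb⟩ := exists_link_over hik hij.le hjk
  have hbk' := le_of_chain hbk
  have hkn := hP.bounds hB hk
  have haB : a ∈ B := (mem_block_iff hQ hpair hB hi a).2
    ⟨Finset.mem_Icc.2 ⟨hab.1, by have := hab.2.1; omega⟩, Or.inl hia⟩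
  have hbB : b ∈ B := (mem_block_iff hQ hpair hB hi b).2
    ⟨Finset.mem_Icc.2 (by omega), Or.inl (hia.tail hab)⟩
  obtain ⟨c, d, hjc, hcd, hdl, hcb, hbd⟩ := exists_link_over hjl hjb.le (by omega : b < l)
  have hjc' := le_of_chain hjc
  have hln := hP.bounds hC hl
  have hcC : c ∈ C := (mem_block_iff hQ hpair hC hj c).2
    ⟨Finset.mem_Icc.2 ⟨hcd.1, by omega⟩, Or.inl hjc⟩
  have haj' : a ≠ j := fun h => hBC (hP.2.2.2 B hB C hC a haB (h ▸ hj))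
  have hcb' : c ≠ b := fun h => hBC (hP.2.2.2 B hB C hC c (h ▸ hbB) hcC)
  exact pairs_not_crossing hnc hab.2.2 hcd.2.2 (by omega) (by omega) (by omega)

/-- The partner of a left copy `2 * a - 1` that does not close a link is a right copy `2 * c`. -/
lemma exists_right_partner {n : ℕ} {Q : Finset (Finset ℕ)}
    (hQ : IsPartitionOf (Finset.Icc 1 (2 * n)) Q) (hpair : IsPairing Q) (hnc : IsNoncrossing Q)
    {a : ℕ} (ha : 1 ≤ a) (han : a ≤ n) (hmin : ∀ c, ¬ Link Q c a) :
    ∃ c, a ≤ c ∧ c ≤ n ∧ {2 * a - 1, 2 * c} ∈ Q := by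
  obtain ⟨y, hy, hne, hmem⟩ := exists_partner hQ hpair (Finset.mem_Icc.2 (by omega) :
    2 * a - 1 ∈ Finset.Icc 1 (2 * n))
  rw [Finset.mem_Icc] at hy
  obtain hlt | hlt := hne.lt_or_gt
  · rw [Finset.pair_comm] at hmem
    obtain ⟨r, hr⟩ := odd_sub_of_pair_mem hQ hpair hnc hlt hmem
    refine absurd ⟨?_, ?_, ?_⟩ (hmin (y / 2))
    · omega
    · omega
    · rwa [show 2 * (y / 2) = y by omega]
  · obtain ⟨r, hr⟩ := odd_sub_of_pair_mem hQ hpair hnc hlt hmem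
    refine ⟨y / 2, by omega, by omega, ?_⟩
    rwa [show 2 * (y / 2) = y by omega]

/-- The partner of a right copy `2 * b` that does not open a link is a left copy `2 * r - 1`. -/
lemma exists_left_partner {n : ℕ} {Q : Finset (Finset ℕ)}
    (hQ : IsPartitionOf (Finset.Icc 1 (2 * n)) Q) (hpair : IsPairing Q) (hnc : IsNoncrossing Q)
    {b : ℕ} (hb : 1 ≤ b) (hbn : b ≤ n) (hmax : ∀ c, c ≤ n → ¬ Link Q b c) :
    ∃ r, 1 ≤ r ∧ r ≤ b ∧ {2 * r - 1, 2 * b} ∈ Q := by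
  obtain ⟨y, hy, hne, hmem⟩ := exists_partner hQ hpair (Finset.mem_Icc.2 (by omega) :
    2 * b ∈ Finset.Icc 1 (2 * n))
  rw [Finset.mem_Icc] at hy
  obtain hlt | hlt := hne.lt_or_gt
  · rw [Finset.pair_comm] at hmem
    obtain ⟨r, hr⟩ := odd_sub_of_pair_mem hQ hpair hnc hlt hmem
    refine ⟨(y + 1) / 2, by omega, by omega, ?_⟩
    rwa [show 2 * ((y + 1) / 2) - 1 = y by omega]
  · obtain ⟨r, hr⟩ := odd_sub_of_pair_mem hQ hpair hnc hlt hmem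
    refine absurd ⟨?_, ?_, ?_⟩ (hmax ((y + 1) / 2) (by omega))
    · omega
    · omega
    · rwa [show 2 * ((y + 1) / 2) - 1 = y by omega]

/-- The two ends of a maximal chain of links are joined by a pair. -/
lemma pair_mem_of_maximal_chain {n : ℕ} {Q : Finset (Finset ℕ)}
    (hQ : IsPartitionOf (Finset.Icc 1 (2 * n)) Q) (hpair : IsPairing Q) (hnc : IsNoncrossing Q)
    {a b : ℕ} (ha : 1 ≤ a) (hbn : b ≤ n) (hab : Relation.ReflTransGen (Link Q) a b)
    (hmin : ∀ c, ¬ Link Q c a) (hmax : ∀ c, c ≤ n → ¬ Link Q b c) :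
    {2 * a - 1, 2 * b} ∈ Q := by
  have hle := le_of_chain hab
  obtain ⟨c, hac, hcn, hc⟩ := exists_right_partner hQ hpair hnc ha (by omega) hmin
  obtain ⟨r, hr, hrb, hr'⟩ := exists_left_partner hQ hpair hnc (by omega) hbn hmax
  obtain hbc | rfl | hcb := lt_trichotomy b c
  · obtain hra | rfl | har := lt_trichotomy r a
    · exact (pairs_not_crossing hnc hr' hc (by omega) (by omega) (by omega)).elim
    · exact hr'
    · obtain ⟨u, v, -, huv, hvb, hur, hrv⟩ :=
        exists_link_over hab (t := r - 1) (by omega) (by omega)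
      have hvb' := le_of_chain hvb
      have huv' := huv.2.2
      obtain rfl | hlt := (show r ≤ v by omega).eq_or_lt
      · rw [Finset.pair_comm] at huv'
        have := pair_partner_unique hQ hpair hr' huv'
        omega
      · exact (pairs_not_crossing hnc huv' hr' (by omega) (by omega) (by omega)).elim
  · exact hc
  · obtain ⟨u, v, hau, huv, -, huc, hcv⟩ := exists_link_over hab hac hcb
    have hau' := le_of_chain hau
    obtain rfl | hlt := huc.eq_or_lt
    · rw [Finset.pair_comm] at hc
      have := pair_partner_unique hQ hpair hc huv.2.2
      omega
    · exact (pairs_not_crossing hnc hc huv.2.2 (by omega) (by omega) (by omega)).elim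

lemma fattening_thinning {n : ℕ} {Q : Finset (Finset ℕ)}
    (hQ : IsPartitionOf (Finset.Icc 1 (2 * n)) Q) (hpair : IsPairing Q) (hnc : IsNoncrossing Q) :
    fattening n (thinning n Q) = Q := by
  have hP := thinning_isPartitionOf hQ hpair
  refine (fattening_isPartitionOf hP).eq_of_subset hQ fun S hS => ?_
  obtain ⟨B, hB, ⟨a, ha, b, hb, h, rfl⟩ | ⟨a, ha, b, hb, hlt, h, rfl⟩⟩ :=
    (mem_fattening hP).1 hS
  all_goals
    have han := hP.bounds hB ha
    have hbn := hP.bounds hB hb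
    have hab := ((mem_block_iff hQ hpair hB ha b).1 hb).2.chain
  · refine pair_mem_of_maximal_chain hQ hpair hnc han.1 hbn.2 (hab (h b hb).1) ?_ ?_
    · intro c hc
      have hca := hc.2.1
      have := h c ((mem_block_iff hQ hpair hB ha c).2
        ⟨Finset.mem_Icc.2 ⟨hc.1, by omega⟩, Or.inr (.single hc)⟩)
      omega
    · intro c hcn hc
      have hbc := hc.2.1
      have := h c ((mem_block_iff hQ hpair hB hb c).2
        ⟨Finset.mem_Icc.2 (by omega), Or.inl (.single hc)⟩)
      omega
  · obtain heq | ⟨c, hac, hcb⟩ := (hab hlt.le).cases_head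
    · omega
    · have hac' := hac.2.1
      have hcb' := le_of_chain hcb
      have := h c ((mem_block_iff hQ hpair hB ha c).2
        ⟨Finset.mem_Icc.2 (by omega), Or.inl (.single hac)⟩)
      obtain rfl : c = b := by omega
      exact hac.2.2

/-- for every `n ≥ 1` there is a bijection `Φ` from the noncrossing partitions of
`{1,…,n}` onto the noncrossing pairings of `{1,…,2n}` such that `|π| = o(Φ(π))` for all `π`. -/
theorem stmt7 (n : ℕ) (hn : 1 ≤ n) :
    ∃ Φ : {P : Finset (Finset ℕ) // IsPartitionOf (Finset.Icc 1 n) P ∧ IsNoncrossing P} →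
        {Q : Finset (Finset ℕ) //
          IsPartitionOf (Finset.Icc 1 (2 * n)) Q ∧ IsPairing Q ∧ IsNoncrossing Q},
      Function.Bijective Φ ∧ ∀ P, (P.1).card = oCount (Φ P).1 := by
  refine ⟨fun P => ⟨fattening n P.1, fattening_isPartitionOf P.2.1,
    fattening_isPairing P.2.1, fattening_isNoncrossing P.2.1 P.2.2⟩, ⟨?_, ?_⟩, ?_⟩
  · rintro ⟨P, hP⟩ ⟨P', hP'⟩ h
    exact Subtype.ext (fattening_injOn hP.1 hP'.1 (congrArg Subtype.val h))
  · rintro ⟨Q, hQ, hpair, hnc⟩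
    exact ⟨⟨thinning n Q, thinning_isPartitionOf hQ hpair, thinning_isNoncrossing hQ hpair hnc⟩,
      Subtype.ext (fattening_thinning hQ hpair hnc)⟩
  · intro P
    exact (oCount_fattening P.2.1).symm
end

section
/- Let λ ∈ (0,1]. Then the function f(x) = √(4λ − (x²−1−λ)²)/(2πλ|x|) for x with (1−√λ)² ≤ x² ≤ (1+√λ)² (and f(x) = 0 otherwise) is the density of a symmetric probability measure ν on ℝ, supported on [−1−√λ, −1+√λ] ∪ [1−√λ, 1+√λ], and for every n ≥ 1 the 2n-th moment of ν equals Σ_π λ^{e(π)}, where the sum is over all noncrossing pairings π of {1,…,2n} and e(π) is the number of blocks of π whose minimal element is even; all odd moments of ν vanish. (ν is the rectangular Gaussian distribution with ratio λ, the image of the standard Gaussian under the rectangular Bercovici–Pata bijection Λ_λ.) -/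
open MeasureTheory Finset Real

instance (s : Finset ℕ) : DecidablePred (fun P => IsPartitionOf s P ∧ IsPairing P ∧
    IsNoncrossing P) := fun P => by
  unfold IsPartitionOf IsPairing IsNoncrossing; infer_instance

/-- The finite set of all noncrossing pairings of `{1, …, m}`. -/
def ncPairings (m : ℕ) : Finset (Finset (Finset ℕ)) :=
  ((Finset.Icc 1 m).powerset.powerset).filter
    (fun P => IsPartitionOf (Finset.Icc 1 m) P ∧ IsPairing P ∧ IsNoncrossing P)

/-- `m` is the minimum of the block `B` and is even. -/
def evenMin (B : Finset ℕ) : Prop := ∃ m ∈ B, Even m ∧ ∀ x ∈ B, m ≤ x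

instance : DecidablePred evenMin := fun B => by unfold evenMin; infer_instance

/-- `e(P)`: the number of blocks of `P` whose minimal element is even. -/
def eCount (P : Finset (Finset ℕ)) : ℕ := (P.filter evenMin).card

/-- The density of the rectangular Gaussian distribution with ratio `λ`. -/
noncomputable def rgDensity (l : ℝ) (x : ℝ) : ℝ :=
  if (1 - Real.sqrt l)^2 ≤ x^2 ∧ x^2 ≤ (1 + Real.sqrt l)^2 then
    Real.sqrt (4*l - (x^2 - 1 - l)^2) / (2 * Real.pi * l * |x|)
  else 0

/-- The rectangular Gaussian distribution with ratio `λ`. -/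
noncomputable def rgMeasure (l : ℝ) : Measure ℝ :=
  volume.withDensity (fun x => ENNReal.ofReal (rgDensity l x))


/-- The noncrossing pairings of the integer interval `[a, b)`. -/
def ncPairingsIco (a b : ℕ) : Finset (Finset (Finset ℕ)) :=
  ((Finset.Ico a b).powerset.powerset).filter
    (fun P => IsPartitionOf (Finset.Ico a b) P ∧ IsPairing P ∧ IsNoncrossing P)

theorem mem_ncPairingsIco {a b : ℕ} {P : Finset (Finset ℕ)} :
    P ∈ ncPairingsIco a b ↔
      IsPartitionOf (Finset.Ico a b) P ∧ IsPairing P ∧ IsNoncrossing P := by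
  simp only [ncPairingsIco, Finset.mem_filter, Finset.mem_powerset, and_iff_right_iff_imp]
  rintro ⟨h, -, -⟩ B hB
  exact Finset.mem_powerset.2 (h.1 B hB)

theorem ncPairings_eq_ncPairingsIco (m : ℕ) : ncPairings m = ncPairingsIco 1 (1 + m) := by
  have h : Finset.Icc 1 m = Finset.Ico 1 (1 + m) := by
    ext x; simp only [Finset.mem_Icc, Finset.mem_Ico]; omega
  simp only [ncPairings, ncPairingsIco, h]

/-- A block of a pairing, with its elements in increasing order. -/
theorem IsPairing.exists_lt {P : Finset (Finset ℕ)} (h : IsPairing P) {B : Finset ℕ}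
    (hB : B ∈ P) : ∃ x y, x < y ∧ B = {x, y} := by
  obtain ⟨x, y, hxy, rfl⟩ := Finset.card_eq_two.1 (h B hB)
  rcases lt_or_gt_of_ne hxy with h | h
  · exact ⟨x, y, h, rfl⟩
  · exact ⟨y, x, h, Finset.pair_comm x y⟩

theorem mem_block_bounds {a b : ℕ} {P : Finset (Finset ℕ)} (hP : P ∈ ncPairingsIco a b)
    {B : Finset ℕ} (hB : B ∈ P) {x : ℕ} (hx : x ∈ B) : a ≤ x ∧ x < b :=
  Finset.mem_Ico.1 ((mem_ncPairingsIco.1 hP).1.1 B hB hx)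

/-- Gluing noncrossing pairings of `(a, c)` and `(c, b)` with the block `{a, c}`. -/
theorem insert_union_mem_ncPairingsIco {a b c : ℕ} {Q R : Finset (Finset ℕ)}
    (hac : a < c) (hcb : c < b)
    (hQ : Q ∈ ncPairingsIco (a + 1) c) (hR : R ∈ ncPairingsIco (c + 1) b) :
    insert {a, c} (Q ∪ R) ∈ ncPairingsIco a b := by
  have bQ := fun B (hB : B ∈ Q) x (hx : x ∈ B) => mem_block_bounds hQ hB hx
  have bR := fun B (hB : B ∈ R) x (hx : x ∈ B) => mem_block_bounds hR hB hx
  obtain ⟨⟨-, neQ, cQ, dQ⟩, pQ, nQ⟩ := mem_ncPairingsIco.1 hQ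
  obtain ⟨⟨-, neR, cR, dR⟩, pR, nR⟩ := mem_ncPairingsIco.1 hR
  refine mem_ncPairingsIco.2 ⟨⟨?_, ?_, ?_, ?_⟩, ?_, ?_⟩
  · intro B hB x hx
    simp only [Finset.mem_insert, Finset.mem_union] at hB
    rw [Finset.mem_Ico]
    rcases hB with rfl | hB | hB
    · simp only [Finset.mem_insert, Finset.mem_singleton] at hx; omega
    · have := bQ B hB x hx; omega
    · have := bR B hB x hx; omega
  · intro B hB
    simp only [Finset.mem_insert, Finset.mem_union] at hB
    rcases hB with rfl | hB | hB
    · simp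
    · exact neQ B hB
    · exact neR B hB
  · intro x hx
    rw [Finset.mem_Ico] at hx
    by_cases h : x = a ∨ x = c
    · exact ⟨{a, c}, by simp, by simpa using h⟩
    · rcases lt_or_gt_of_ne (show x ≠ c by tauto) with h' | h'
      · obtain ⟨B, hB, hxB⟩ := cQ x (by rw [Finset.mem_Ico]; omega)
        exact ⟨B, by simp [hB], hxB⟩
      · obtain ⟨B, hB, hxB⟩ := cR x (by rw [Finset.mem_Ico]; omega)
        exact ⟨B, by simp [hB], hxB⟩
  · intro B hB C hC x hxB hxC
    simp only [Finset.mem_insert, Finset.mem_union] at hB hC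
    grind
  · intro B hB
    simp only [Finset.mem_insert, Finset.mem_union] at hB
    rcases hB with rfl | hB | hB
    · exact Finset.card_pair hac.ne
    · exact pQ B hB
    · exact pR B hB
  · rintro ⟨B, hB, C, hC, hBC, i, hi, j, hj, k, hk, m, hm, hij, hjk, hkm⟩
    simp only [Finset.mem_insert, Finset.mem_union] at hB hC
    rcases hB with rfl | hB | hB <;> rcases hC with rfl | hC | hC
    · exact hBC rfl
    · have := bQ C hC j hj; have := bQ C hC m hm
      simp only [Finset.mem_insert, Finset.mem_singleton] at hi hk; omega
    · have := bR C hC j hj; have := bR C hC m hm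
      simp only [Finset.mem_insert, Finset.mem_singleton] at hi hk; omega
    · have := bQ B hB i hi; have := bQ B hB k hk
      simp only [Finset.mem_insert, Finset.mem_singleton] at hj hm; omega
    · exact nQ ⟨B, hB, C, hC, hBC, i, hi, j, hj, k, hk, m, hm, hij, hjk, hkm⟩
    · have := bQ B hB k hk; have := bR C hC j hj; omega
    · have := bR B hB i hi; have := bR B hB k hk
      simp only [Finset.mem_insert, Finset.mem_singleton] at hj hm; omega
    · have := bR B hB i hi; have := bQ C hC j hj; omega
    · exact nR ⟨B, hB, C, hC, hBC, i, hi, j, hj, k, hk, m, hm, hij, hjk, hkm⟩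

/-- Restricting a noncrossing pairing to the blocks inside a subinterval whose points are only
covered by such blocks. -/
theorem filter_subset_mem_ncPairingsIco {a b u v : ℕ} {P : Finset (Finset ℕ)}
    (hP : P ∈ ncPairingsIco a b) (hau : a ≤ u) (hvb : v ≤ b)
    (h : ∀ B ∈ P, ∀ x ∈ B, x ∈ Finset.Ico u v → B ⊆ Finset.Ico u v) :
    P.filter (· ⊆ Finset.Ico u v) ∈ ncPairingsIco u v := by
  obtain ⟨⟨-, ne, cov, dis⟩, pair, nc⟩ := mem_ncPairingsIco.1 hP
  refine mem_ncPairingsIco.2 ⟨⟨fun B hB => (Finset.mem_filter.1 hB).2,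
    fun B hB => ne B (Finset.mem_filter.1 hB).1, fun x hx => ?_,
    fun B hB C hC => dis B (Finset.mem_filter.1 hB).1 C (Finset.mem_filter.1 hC).1⟩,
    fun B hB => pair B (Finset.mem_filter.1 hB).1, ?_⟩
  · obtain ⟨B, hB, hxB⟩ := cov x (Finset.Ico_subset_Ico hau hvb hx)
    exact ⟨B, Finset.mem_filter.2 ⟨hB, h B hB x hxB hx⟩, hxB⟩
  · rintro ⟨B, hB, C, hC, hr⟩
    exact nc ⟨B, (Finset.mem_filter.1 hB).1, C, (Finset.mem_filter.1 hC).1, hr⟩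

/-- Every noncrossing pairing of `[a, b)` splits along the block of `a`. -/
theorem exists_eq_insert_union_of_mem_ncPairingsIco {a b : ℕ} (hab : a < b)
    {P : Finset (Finset ℕ)} (hP : P ∈ ncPairingsIco a b) :
    ∃ c, a < c ∧ c < b ∧ ∃ Q ∈ ncPairingsIco (a + 1) c, ∃ R ∈ ncPairingsIco (c + 1) b,
      insert {a, c} (Q ∪ R) = P := by
  obtain ⟨⟨-, ne, cov, dis⟩, pair, nc⟩ := mem_ncPairingsIco.1 hP
  obtain ⟨A, hA, haA⟩ := cov a (by simpa using hab)
  obtain ⟨x, c, hxc, rfl⟩ := pair.exists_lt hA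
  have hx : x = a := by
    have := (mem_block_bounds hP hA (Finset.mem_insert_self x {c})).1
    simp only [Finset.mem_insert, Finset.mem_singleton] at haA
    omega
  subst hx
  have hcb := (mem_block_bounds hP hA (x := c) (by simp)).2
  have key : ∀ B ∈ P, B = {x, c} ∨ B ⊆ Finset.Ico (x + 1) c ∨ B ⊆ Finset.Ico (c + 1) b := by
    intro B hB
    by_cases hBA : B = {x, c}
    · exact Or.inl hBA
    right
    obtain ⟨y, z, hyz, rfl⟩ := pair.exists_lt hB
    have hyb := mem_block_bounds hP hB (x := y) (by simp)
    have hzb := mem_block_bounds hP hB (x := z) (by simp)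
    have hne : ∀ w ∈ ({y, z} : Finset ℕ), w ≠ x ∧ w ≠ c := by
      intro w hw
      constructor <;> rintro rfl <;> exact hBA (dis _ hB _ hA w hw (by simp))
    have hy := hne y (by simp)
    have hz := hne z (by simp)
    have hcross : ¬ (y < c ∧ c < z) := fun h => nc ⟨_, hA, _, hB, Ne.symm hBA, x, by simp, y,
      by simp, c, by simp, z, by simp, by omega, h.1, h.2⟩
    simp only [Finset.insert_subset_iff, Finset.singleton_subset_iff, Finset.mem_Ico]
    omega
  refine ⟨c, hxc, hcb, P.filter (· ⊆ Finset.Ico (x + 1) c),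
    filter_subset_mem_ncPairingsIco hP (by omega) hcb.le ?_,
    P.filter (· ⊆ Finset.Ico (c + 1) b),
    filter_subset_mem_ncPairingsIco hP (by omega) le_rfl ?_, ?_⟩
  · intro B hB y hy hyI
    rw [Finset.mem_Ico] at hyI
    rcases key B hB with rfl | h | h
    · simp only [Finset.mem_insert, Finset.mem_singleton] at hy; omega
    · exact h
    · have := Finset.mem_Ico.1 (h hy); omega
  · intro B hB y hy hyI
    rw [Finset.mem_Ico] at hyI
    rcases key B hB with rfl | h | h
    · simp only [Finset.mem_insert, Finset.mem_singleton] at hy; omega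
    · have := Finset.mem_Ico.1 (h hy); omega
    · exact h
  · ext B
    simp only [Finset.mem_insert, Finset.mem_union, Finset.mem_filter]
    constructor
    · rintro (rfl | h | h)
      exacts [hA, h.1, h.1]
    · intro hB
      have := key B hB
      tauto

theorem partner_eq_of_insert_union_eq {a b c c' : ℕ} {Q R Q' R' : Finset (Finset ℕ)}
    (hP : insert {a, c} (Q ∪ R) ∈ ncPairingsIco a b) (hac : a < c)
    (h : insert {a, c} (Q ∪ R) = insert {a, c'} (Q' ∪ R')) : c = c' := by
  have h1 : ({a, c} : Finset ℕ) ∈ insert {a, c} (Q ∪ R) := Finset.mem_insert_self _ _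
  have h2 : ({a, c'} : Finset ℕ) ∈ insert {a, c} (Q ∪ R) := h ▸ Finset.mem_insert_self _ _
  have h3 := (mem_ncPairingsIco.1 hP).1.2.2.2 _ h1 _ h2 a (by simp) (by simp)
  have h4 : c ∈ ({a, c'} : Finset ℕ) := h3 ▸ (by simp)
  simp only [Finset.mem_insert, Finset.mem_singleton] at h4
  omega

theorem filter_insert_union_left {a b c : ℕ} {Q R : Finset (Finset ℕ)}
    (hQ : Q ∈ ncPairingsIco (a + 1) c) (hR : R ∈ ncPairingsIco (c + 1) b) :
    (insert {a, c} (Q ∪ R)).filter (· ⊆ Finset.Ico (a + 1) c) = Q := by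
  ext B
  simp only [Finset.mem_filter, Finset.mem_insert, Finset.mem_union]
  constructor
  · rintro ⟨rfl | hB | hB, hs⟩
    · have := Finset.mem_Ico.1 (hs (Finset.mem_insert_self a {c})); omega
    · exact hB
    · obtain ⟨x, hx⟩ := (mem_ncPairingsIco.1 hR).1.2.1 B hB
      have := mem_block_bounds hR hB hx
      have := Finset.mem_Ico.1 (hs hx)
      omega
  · exact fun hB => ⟨Or.inr (Or.inl hB), (mem_ncPairingsIco.1 hQ).1.1 B hB⟩

theorem filter_insert_union_right {a b c : ℕ} {Q R : Finset (Finset ℕ)}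
    (hQ : Q ∈ ncPairingsIco (a + 1) c) (hR : R ∈ ncPairingsIco (c + 1) b) :
    (insert {a, c} (Q ∪ R)).filter (· ⊆ Finset.Ico (c + 1) b) = R := by
  ext B
  simp only [Finset.mem_filter, Finset.mem_insert, Finset.mem_union]
  constructor
  · rintro ⟨rfl | hB | hB, hs⟩
    · have := Finset.mem_Ico.1 (hs (show c ∈ ({a, c} : Finset ℕ) by simp)); omega
    · obtain ⟨x, hx⟩ := (mem_ncPairingsIco.1 hQ).1.2.1 B hB
      have := mem_block_bounds hQ hB hx
      have := Finset.mem_Ico.1 (hs hx)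
      omega
    · exact hB
  · exact fun hB => ⟨Or.inr (Or.inr hB), (mem_ncPairingsIco.1 hR).1.1 B hB⟩

theorem evenMin_pair {a c : ℕ} (hac : a < c) : evenMin {a, c} ↔ Even a := by
  constructor
  · rintro ⟨m, hm, he, hle⟩
    have := hle a (by simp)
    simp only [Finset.mem_insert, Finset.mem_singleton] at hm
    obtain rfl : m = a := by omega
    exact he
  · intro h
    refine ⟨a, by simp, h, fun x hx => ?_⟩
    simp only [Finset.mem_insert, Finset.mem_singleton] at hx
    omega

theorem pow_eCount_insert_union (l : ℝ) {a b c : ℕ} {Q R : Finset (Finset ℕ)} (hac : a < c)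
    (hQ : Q ∈ ncPairingsIco (a + 1) c) (hR : R ∈ ncPairingsIco (c + 1) b) :
    l ^ eCount (insert {a, c} (Q ∪ R)) =
      (if Even a then l else 1) * (l ^ eCount Q * l ^ eCount R) := by
  have hdis : Disjoint Q R := by
    rw [Finset.disjoint_left]
    intro B hBQ hBR
    obtain ⟨x, hx⟩ := (mem_ncPairingsIco.1 hQ).1.2.1 B hBQ
    have := mem_block_bounds hQ hBQ hx
    have := mem_block_bounds hR hBR hx
    omega
  have hnot : ({a, c} : Finset ℕ) ∉ Q ∪ R := by
    rw [Finset.mem_union]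
    rintro (h | h)
    · have := mem_block_bounds hQ h (x := a) (by simp); omega
    · have := mem_block_bounds hR h (x := a) (by simp); omega
  have hcard : eCount (Q ∪ R) = eCount Q + eCount R := by
    rw [eCount, Finset.filter_union, Finset.card_union_of_disjoint
      (Finset.disjoint_filter_filter hdis), eCount, eCount]
  rw [eCount, Finset.filter_insert, ← pow_add, ← hcard]
  simp only [evenMin_pair hac]
  split_ifs
  · rw [Finset.card_insert_of_notMem fun h => hnot (Finset.mem_filter.1 h).1, pow_succ', eCount]
  · rw [one_mul, eCount]

/-- The generating polynomial of `eCount` over noncrossing pairings of `[a, b)`. -/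
noncomputable def ncWeight (l : ℝ) (a b : ℕ) : ℝ := ∑ P ∈ ncPairingsIco a b, l ^ eCount P

theorem ncWeight_self (l : ℝ) (a : ℕ) : ncWeight l a a = 1 := by
  have : ncPairingsIco a a = {∅} := by
    ext P
    rw [mem_ncPairingsIco, Finset.mem_singleton]
    constructor
    · rintro ⟨⟨hs, ne, -, -⟩, -, -⟩
      refine Finset.eq_empty_of_forall_notMem fun B hB => ?_
      obtain ⟨x, hx⟩ := ne B hB
      simpa using hs B hB hx
    · rintro rfl
      simp [IsPartitionOf, IsPairing, IsNoncrossing]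
  simp [ncWeight, this, eCount]

/-- Decomposition according to the partner `c` of the first point. -/
theorem ncWeight_eq_sum (l : ℝ) {a b : ℕ} (hab : a < b) :
    ncWeight l a b = (if Even a then l else 1) *
      ∑ c ∈ Finset.Ioo a b, ncWeight l (a + 1) c * ncWeight l (c + 1) b := by
  simp only [ncWeight, Finset.sum_mul_sum, ← Finset.sum_product']
  rw [Finset.sum_sigma', Finset.mul_sum]
  symm
  refine Finset.sum_nbij (fun s => insert {a, s.1} (s.2.1 ∪ s.2.2)) ?_ ?_ ?_ ?_
  · rintro ⟨c, Q, R⟩ h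
    simp only [Finset.mem_sigma, Finset.mem_Ioo, Finset.mem_product] at h
    exact insert_union_mem_ncPairingsIco h.1.1 h.1.2 h.2.1 h.2.2
  · rintro ⟨c, Q, R⟩ h ⟨c', Q', R'⟩ h' heq
    simp only [Finset.coe_sigma, Set.mem_sigma_iff, Finset.mem_coe, Finset.mem_Ioo,
      Finset.mem_product] at h h'
    dsimp only at heq
    obtain rfl := partner_eq_of_insert_union_eq
      (insert_union_mem_ncPairingsIco h.1.1 h.1.2 h.2.1 h.2.2) h.1.1 heq
    have hQ : Q = Q' := by
      rw [← filter_insert_union_left h.2.1 h.2.2, heq, filter_insert_union_left h'.2.1 h'.2.2]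
    have hR : R = R' := by
      rw [← filter_insert_union_right h.2.1 h.2.2, heq, filter_insert_union_right h'.2.1 h'.2.2]
    rw [hQ, hR]
  · intro P hP
    obtain ⟨c, hac, hcb, Q, hQ, R, hR, rfl⟩ :=
      exists_eq_insert_union_of_mem_ncPairingsIco hab (Finset.mem_coe.1 hP)
    refine ⟨⟨c, Q, R⟩, ?_, rfl⟩
    simp only [Finset.coe_sigma, Set.mem_sigma_iff, Finset.mem_coe, Finset.mem_Ioo,
      Finset.mem_product]
    exact ⟨⟨hac, hcb⟩, hQ, hR⟩
  · rintro ⟨c, Q, R⟩ h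
    simp only [Finset.mem_sigma, Finset.mem_Ioo, Finset.mem_product] at h
    exact (pow_eCount_insert_union l h.1.1 h.2.1 h.2.2).symm

theorem ncWeight_add_succ (l : ℝ) (a m : ℕ) :
    ncWeight l a (a + m + 1) = (if Even a then l else 1) *
      ∑ j ∈ Finset.range m,
        ncWeight l (a + 1) (a + 1 + j) * ncWeight l (a + j + 2) (a + m + 1) := by
  rw [ncWeight_eq_sum l (by omega)]
  refine congrArg _ ?_
  have : Finset.Ioo a (a + m + 1) = Finset.Ico (a + 1) (a + m + 1) := by
    ext x; simp only [Finset.mem_Ioo, Finset.mem_Ico]; omega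
  rw [this, Finset.sum_Ico_eq_sum_range, show a + m + 1 - (a + 1) = m by omega]
  refine Finset.sum_congr rfl fun j _ => ?_
  rw [show a + 1 + j + 1 = a + j + 2 by ring]

theorem ncWeight_odd (l : ℝ) (n : ℕ) : ∀ a, ncWeight l a (a + 2 * n + 1) = 0 := by
  induction n using Nat.strong_induction_on with
  | _ n ih =>
    intro a
    rw [ncWeight_add_succ, Finset.sum_eq_zero, mul_zero]
    intro j hj
    rw [Finset.mem_range] at hj
    obtain ⟨k, rfl | rfl⟩ := Nat.even_or_odd' j
    · have := ih (n - k - 1) (by omega) (a + 2 * k + 2)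
      rw [show a + 2 * k + 2 + 2 * (n - k - 1) + 1 = a + 2 * n + 1 by omega] at this
      rw [this, mul_zero]
    · have := ih k (by omega) (a + 1)
      rw [← add_assoc, this, zero_mul]

theorem sum_range_two_mul_add_one_of_odd_eq_zero (f : ℕ → ℝ) (n : ℕ)
    (h : ∀ k < n, f (2 * k + 1) = 0) :
    ∑ j ∈ Finset.range (2 * n + 1), f j = ∑ k ∈ Finset.range (n + 1), f (2 * k) := by
  induction n with
  | zero => simp
  | succ n ih =>
    rw [show 2 * (n + 1) + 1 = 2 * n + 1 + 1 + 1 by ring, Finset.sum_range_succ,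
      Finset.sum_range_succ, ih fun k hk => h k (by omega), h n (by omega),
      Finset.sum_range_succ _ (n + 1)]
    ring_nf

theorem ncWeight_even_succ (l : ℝ) (a n : ℕ) :
    ncWeight l a (a + 2 * (n + 1)) = (if Even a then l else 1) *
      ∑ k ∈ Finset.range (n + 1), ncWeight l (a + 1) (a + 1 + 2 * k) *
        ncWeight l (a + 2 * k + 2) (a + 2 * k + 2 + 2 * (n - k)) := by
  rw [show a + 2 * (n + 1) = a + (2 * n + 1) + 1 by ring, ncWeight_add_succ,
    sum_range_two_mul_add_one_of_odd_eq_zero]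
  · refine congrArg _ ?_
    refine Finset.sum_congr rfl fun k hk => ?_
    rw [Finset.mem_range] at hk
    rw [show a + 2 * k + 2 + 2 * (n - k) = a + (2 * n + 1) + 1 by omega]
  · intro k _
    rw [← add_assoc, ncWeight_odd, zero_mul]

/-- Only the parity of the left end point matters. -/
theorem ncWeight_add_two (l : ℝ) (n : ℕ) :
    ∀ a, ncWeight l (a + 2) (a + 2 + 2 * n) = ncWeight l a (a + 2 * n) := by
  induction n using Nat.strong_induction_on with
  | _ n ih =>
    intro a
    cases n with
    | zero => simp [ncWeight_self]
    | succ n =>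
      rw [ncWeight_even_succ, ncWeight_even_succ]
      have : Even (a + 2) ↔ Even a := by simp [Nat.even_add]
      simp only [this]
      refine congrArg _ ?_
      refine Finset.sum_congr rfl fun k hk => ?_
      rw [Finset.mem_range] at hk
      have h1 := ih k (by omega) (a + 1)
      have h2 := ih (n - k) (by omega) (a + 2 * k + 2)
      rw [show a + 2 + 1 = a + 1 + 2 by ring, h1,
        show a + 2 + 2 * k + 2 = a + 2 * k + 2 + 2 by ring, h2]

theorem ncWeight_add_two_mul (l : ℝ) (a k n : ℕ) :
    ncWeight l (a + 2 * k) (a + 2 * k + 2 * n) = ncWeight l a (a + 2 * n) := by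
  induction k with
  | zero => simp
  | succ k ih => rw [← ih, ← ncWeight_add_two l n (a + 2 * k)]; ring_nf

theorem ncWeight_one_succ (l : ℝ) (n : ℕ) :
    ncWeight l 1 (1 + 2 * (n + 1)) = ∑ k ∈ Finset.range (n + 1),
      ncWeight l 2 (2 + 2 * k) * ncWeight l 1 (1 + 2 * (n - k)) := by
  rw [ncWeight_even_succ, if_neg (by decide), one_mul]
  refine Finset.sum_congr rfl fun k _ => ?_
  rw [show 1 + 2 * k + 2 = 1 + 2 * (k + 1) by ring, ncWeight_add_two_mul]

theorem ncWeight_two_succ (l : ℝ) (n : ℕ) :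
    ncWeight l 2 (2 + 2 * (n + 1)) = l * ncWeight l 1 (1 + 2 * (n + 1)) := by
  rw [ncWeight_even_succ, if_pos (by decide), ncWeight_one_succ]
  refine congrArg _ ?_
  rw [← Finset.sum_range_reflect]
  refine Finset.sum_congr rfl fun k hk => ?_
  rw [Finset.mem_range] at hk
  rw [show n + 1 - 1 - k = n - k by omega, show n - (n - k) = k by omega,
    show 2 + 2 * (n - k) + 2 = 2 + 2 * (n - k + 1) by ring, ncWeight_add_two_mul,
    show 2 + 1 = 1 + 2 by ring, ncWeight_add_two, mul_comm]

/-- The quadratic recurrence of the Narayana-type polynomials `∑_π l ^ e(π)`. -/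
theorem ncWeight_one_succ_succ (l : ℝ) (n : ℕ) :
    ncWeight l 1 (1 + 2 * (n + 2)) = (1 + l) * ncWeight l 1 (1 + 2 * (n + 1)) +
      l * ∑ i ∈ Finset.range n,
        ncWeight l 1 (1 + 2 * (i + 1)) * ncWeight l 1 (1 + 2 * (n - 1 - i + 1)) := by
  rw [ncWeight_one_succ, Finset.sum_range_succ', Finset.sum_range_succ]
  simp only [ncWeight_two_succ, mul_zero, add_zero, ncWeight_self, tsub_self, mul_one, one_mul,
    tsub_zero]
  rw [Finset.mul_sum]
  have : ∀ k ∈ Finset.range n, l * ncWeight l 1 (1 + 2 * (k + 1)) *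
      ncWeight l 1 (1 + 2 * (n + 1 - (k + 1))) = l * (ncWeight l 1 (1 + 2 * (k + 1)) *
        ncWeight l 1 (1 + 2 * (n - 1 - k + 1))) := by
    intro k hk
    rw [Finset.mem_range] at hk
    rw [show n + 1 - (k + 1) = n - 1 - k + 1 by omega, mul_assoc]
  rw [Finset.sum_congr rfl this]
  ring

/-- The recurrence determines the sums over noncrossing pairings. -/
theorem ncWeight_one_eq_of_recurrence (l : ℝ) (s : ℕ → ℝ) (h0 : s 0 = 1)
    (hs : ∀ n, s (n + 1) = (1 + l) * s n + l * ∑ i ∈ Finset.range n, s i * s (n - 1 - i))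
    (n : ℕ) : ncWeight l 1 (1 + 2 * (n + 1)) = s n := by
  induction n using Nat.strong_induction_on with
  | _ n ih =>
    cases n with
    | zero =>
      rw [ncWeight_one_succ, h0]
      simp [ncWeight_self]
    | succ n =>
      rw [ncWeight_one_succ_succ, hs, ih n (by omega)]
      refine congrArg (fun t => (1 + l) * s n + l * t) ?_
      refine Finset.sum_congr rfl fun i hi => ?_
      rw [Finset.mem_range] at hi
      rw [ih i (by omega), ih (n - 1 - i) (by omega)]

section Semicircle

open Polynomial

/-- Applying a functional `L` in the second variable of the divided difference of a polynomial. -/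
noncomputable def dividedDiff (L : ℝ[X] →ₗ[ℝ] ℝ) : ℝ[X] →ₗ[ℝ] ℝ[X] :=
  (Polynomial.basisMonomials ℝ).constr ℝ
    fun n => ∑ i ∈ Finset.range n, L (X ^ (n - 1 - i)) • X ^ i

theorem dividedDiff_X_pow (L : ℝ[X] →ₗ[ℝ] ℝ) (n : ℕ) :
    dividedDiff L (X ^ n) = ∑ i ∈ Finset.range n, L (X ^ (n - 1 - i)) • X ^ i := by
  have h := (Polynomial.basisMonomials ℝ).constr_basis ℝ
    (fun n => ∑ i ∈ Finset.range n, L (X ^ (n - 1 - i)) • (X : ℝ[X]) ^ i) n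
  simpa only [Polynomial.coe_basisMonomials, Polynomial.monomial_one_right_eq_X_pow,
    dividedDiff] using h

theorem linearMap_ext_X_pow {M : Type*} [AddCommMonoid M] [Module ℝ M] {f g : ℝ[X] →ₗ[ℝ] M}
    (h : ∀ n : ℕ, f (X ^ n) = g (X ^ n)) : f = g := by
  refine Polynomial.lhom_ext' fun n => LinearMap.ext_ring ?_
  simpa [Polynomial.monomial_one_right_eq_X_pow] using h n

theorem dividedDiff_X_mul (L : ℝ[X] →ₗ[ℝ] ℝ) (p : ℝ[X]) :
    dividedDiff L (X * p) = X * dividedDiff L p + C (L p) := by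
  have h : dividedDiff L ∘ₗ LinearMap.mulLeft ℝ X =
      LinearMap.mulLeft ℝ X ∘ₗ dividedDiff L + Polynomial.CAlgHom.toLinearMap ∘ₗ L := by
    refine linearMap_ext_X_pow fun n => ?_
    simp only [LinearMap.comp_apply, LinearMap.add_apply, LinearMap.mulLeft_apply, ← pow_succ',
      dividedDiff_X_pow, Finset.mul_sum, Finset.sum_range_succ']
    congr 1
    · refine Finset.sum_congr rfl fun i _ => ?_
      rw [mul_smul_comm, ← pow_succ', show n + 1 - 1 - (i + 1) = n - 1 - i by omega]
    · simp [Polynomial.smul_eq_C_mul]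
  exact LinearMap.congr_fun h p

theorem dividedDiff_affine_mul (L : ℝ[X] →ₗ[ℝ] ℝ) (a b : ℝ) (p : ℝ[X]) :
    dividedDiff L ((C a + C b * X) * p) =
      (C a + C b * X) * dividedDiff L p + C (b * L p) := by
  rw [show (C a + C b * X) * p = a • p + b • (X * p) by
    simp only [Polynomial.smul_eq_C_mul]; ring, map_add, map_smul, map_smul, dividedDiff_X_mul]
  simp only [Polynomial.smul_eq_C_mul, C_mul]
  ring

theorem dividedDiff_affine_pow (L : ℝ[X] →ₗ[ℝ] ℝ) (a b : ℝ) (n : ℕ) :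
    dividedDiff L ((C a + C b * X) ^ n) =
      ∑ i ∈ Finset.range n, C (b * L ((C a + C b * X) ^ (n - 1 - i))) * (C a + C b * X) ^ i := by
  induction n with
  | zero => simpa using dividedDiff_X_pow L 0
  | succ n ih =>
    rw [pow_succ', dividedDiff_affine_mul, ih, Finset.sum_range_succ', Finset.mul_sum]
    congr 1
    · refine Finset.sum_congr rfl fun i _ => ?_
      rw [show n + 1 - 1 - (i + 1) = n - 1 - i by omega]
      ring
    · simp

/-- If the moments of `L` satisfy the Catalan-type recurrence, the moments of its affine images
satisfy a quadratic recurrence. -/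
theorem affine_moment_recurrence (L : ℝ[X] →ₗ[ℝ] ℝ)
    (hL : ∀ n : ℕ, L (X ^ (n + 1)) = ∑ i ∈ Finset.range n, L (X ^ i) * L (X ^ (n - 1 - i)))
    (a b : ℝ) (n : ℕ) :
    L ((C a + C b * X) ^ (n + 1)) = a * L ((C a + C b * X) ^ n) +
      b ^ 2 * ∑ i ∈ Finset.range n,
        L ((C a + C b * X) ^ i) * L ((C a + C b * X) ^ (n - 1 - i)) := by
  have h : L ∘ₗ LinearMap.mulLeft ℝ X = L ∘ₗ dividedDiff L := by
    refine linearMap_ext_X_pow fun k => ?_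
    simp only [LinearMap.comp_apply, LinearMap.mulLeft_apply, ← pow_succ', dividedDiff_X_pow, hL,
      map_sum, map_smul, smul_eq_mul]
    exact Finset.sum_congr rfl fun i _ => mul_comm _ _
  have h' := LinearMap.congr_fun h ((C a + C b * X) ^ n)
  simp only [LinearMap.comp_apply, LinearMap.mulLeft_apply] at h'
  rw [pow_succ', show (C a + C b * X) * (C a + C b * X) ^ n = a • (C a + C b * X) ^ n +
    b • (X * (C a + C b * X) ^ n) by simp only [Polynomial.smul_eq_C_mul]; ring, map_add, map_smul,
    map_smul, h', dividedDiff_affine_pow]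
  simp only [map_sum, ← Polynomial.smul_eq_C_mul, map_smul, smul_eq_mul, Finset.mul_sum]
  congr 1
  exact Finset.sum_congr rfl fun i _ => by ring

/-- Integration against the semicircle distribution, in the parametrization `t = 2 cos θ`. -/
noncomputable def semicircle : ℝ[X] →ₗ[ℝ] ℝ where
  toFun p := 2 / π * ∫ θ in (0 : ℝ)..π, p.eval (2 * cos θ) * sin θ ^ 2
  map_add' p q := by
    simp only [Polynomial.eval_add, add_mul]
    rw [intervalIntegral.integral_add, mul_add] <;>
      exact Continuous.intervalIntegrable (by fun_prop) _ _
  map_smul' c p := by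
    simp only [Polynomial.eval_smul, smul_eq_mul, mul_assoc, RingHom.id_apply]
    rw [intervalIntegral.integral_const_mul]
    ring

theorem semicircle_apply (p : ℝ[X]) :
    semicircle p = 2 / π * ∫ θ in (0 : ℝ)..π, p.eval (2 * cos θ) * sin θ ^ 2 := rfl

theorem semicircle_X_pow (n : ℕ) :
    semicircle (X ^ n) = 2 / π * 2 ^ n * ((∫ θ in (0 : ℝ)..π, cos θ ^ n) / (n + 2)) := by
  have h : ∀ θ : ℝ, (2 * cos θ) ^ n * sin θ ^ 2 = 2 ^ n * (cos θ ^ n - cos θ ^ (n + 2)) := by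
    intro θ; rw [Real.sin_sq]; ring
  simp only [semicircle_apply, Polynomial.eval_pow, Polynomial.eval_X, h]
  rw [intervalIntegral.integral_const_mul, intervalIntegral.integral_sub, integral_cos_pow]
  · have : (n : ℝ) + 2 ≠ 0 := by positivity
    simp only [sin_pi, sin_zero, mul_zero, sub_zero, zero_div, zero_add]
    field_simp
    ring
  all_goals exact Continuous.intervalIntegrable (by fun_prop) _ _

theorem integral_cos_pow_odd (k : ℕ) : ∫ θ in (0 : ℝ)..π, cos θ ^ (2 * k + 1) = 0 := by
  induction k with
  | zero => simp
  | succ k ih =>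
    rw [show 2 * (k + 1) + 1 = 2 * k + 1 + 2 by ring, integral_cos_pow, ih]
    simp

theorem integral_cos_pow_even (k : ℕ) :
    4 ^ k * ∫ θ in (0 : ℝ)..π, cos θ ^ (2 * k) = π * k.centralBinom := by
  induction k with
  | zero => simp
  | succ k ih =>
    have h := congrArg (Nat.cast (R := ℝ)) (Nat.succ_mul_centralBinom_succ k)
    push_cast at h
    rw [show 2 * (k + 1) = 2 * k + 2 by ring, integral_cos_pow]
    simp only [sin_pi, sin_zero, mul_zero, sub_zero, zero_div, zero_add]
    have hk : (k : ℝ) + 1 ≠ 0 := by positivity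
    have hk' : (2 : ℝ) * k + 2 ≠ 0 := by positivity
    apply mul_left_cancel₀ hk
    calc _ = 2 * (2 * k + 1) * (4 ^ k * ∫ θ in (0 : ℝ)..π, cos θ ^ (2 * k)) := by
          push_cast; field_simp; ring
      _ = _ := by rw [ih]; linear_combination -π * h

theorem semicircle_X_pow_odd (k : ℕ) : semicircle (X ^ (2 * k + 1)) = 0 := by
  rw [semicircle_X_pow, integral_cos_pow_odd]; simp

theorem semicircle_X_pow_even (k : ℕ) : semicircle (X ^ (2 * k)) = catalan k := by
  have h := congrArg (Nat.cast (R := ℝ)) (succ_mul_catalan_eq_centralBinom k)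
  push_cast at h
  have h2 := integral_cos_pow_even k
  have hk : (k : ℝ) + 1 ≠ 0 := by positivity
  have hk' : (2 : ℝ) * k + 2 ≠ 0 := by positivity
  rw [semicircle_X_pow, pow_mul]
  norm_num only
  calc _ = 2 / π * (4 ^ k * ∫ θ in (0 : ℝ)..π, cos θ ^ (2 * k)) / (2 * k + 2) := by
        push_cast; ring
    _ = _ := by
        rw [h2, ← h]
        have := Real.pi_ne_zero
        field_simp

theorem semicircle_X_pow_succ (n : ℕ) : semicircle (X ^ (n + 1)) =
    ∑ i ∈ Finset.range n, semicircle (X ^ i) * semicircle (X ^ (n - 1 - i)) := by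
  obtain ⟨k, rfl | rfl⟩ := Nat.even_or_odd' n
  · rw [semicircle_X_pow_odd, Finset.sum_eq_zero]
    intro i hi
    rw [Finset.mem_range] at hi
    obtain ⟨j, rfl | rfl⟩ := Nat.even_or_odd' i
    · rw [show 2 * k - 1 - 2 * j = 2 * (k - j - 1) + 1 by omega, semicircle_X_pow_odd, mul_zero]
    · rw [semicircle_X_pow_odd, zero_mul]
  · rw [sum_range_two_mul_add_one_of_odd_eq_zero _ _ fun j _ => by
      rw [semicircle_X_pow_odd, zero_mul], show 2 * k + 1 + 1 = 2 * (k + 1) by ring,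
      semicircle_X_pow_even, catalan_succ, Finset.sum_range]
    rw [Nat.cast_sum]
    refine Finset.sum_congr rfl fun i _ => ?_
    rw [Nat.cast_mul, show 2 * k + 1 - 1 - 2 * (i : ℕ) = 2 * (k - i) by omega, semicircle_X_pow_even,
      semicircle_X_pow_even]

end Semicircle

theorem rgDensity_eq {l : ℝ} (hl : 0 < l) (x : ℝ) :
    rgDensity l x = √(4 * l - (x ^ 2 - 1 - l) ^ 2) / (2 * π * l * |x|) := by
  rw [rgDensity]
  split_ifs with h
  · rfl
  · have hr : √l ^ 2 = l := Real.sq_sqrt hl.le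
    have hr0 : 0 < √l := Real.sqrt_pos.2 hl
    rw [Real.sqrt_eq_zero_of_nonpos, zero_div]
    have hfac : 4 * l - (x ^ 2 - 1 - l) ^ 2 =
        -((x ^ 2 - (1 - √l) ^ 2) * (x ^ 2 - (1 + √l) ^ 2)) := by
      linear_combination (√l ^ 2 + l - 2 * x ^ 2 - 2) * hr
    rw [hfac, neg_nonpos]
    by_cases h1 : (1 - √l) ^ 2 ≤ x ^ 2
    · exact mul_nonneg (sub_nonneg.2 h1) (sub_nonneg.2 (not_le.1 fun h2 => h ⟨h1, h2⟩).le)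
    · have h1' := not_le.1 h1
      exact mul_nonneg_of_nonpos_of_nonpos (by linarith) (by nlinarith)

theorem rgDensity_neg (l x : ℝ) : rgDensity l (-x) = rgDensity l x := by
  simp [rgDensity]

theorem rgDensity_abs (l x : ℝ) : rgDensity l |x| = rgDensity l x := by
  simp [rgDensity]

theorem rgDensity_nonneg {l : ℝ} (hl : 0 < l) (x : ℝ) : 0 ≤ rgDensity l x := by
  rw [rgDensity_eq hl]; positivity

theorem measurable_rgDensity {l : ℝ} (hl : 0 < l) : Measurable (rgDensity l) := by
  have : rgDensity l = fun x => √(4 * l - (x ^ 2 - 1 - l) ^ 2) / (2 * π * l * |x|) :=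
    funext (rgDensity_eq hl)
  rw [this]
  fun_prop

theorem rgDensity_eq_zero {l : ℝ} (hl : l ≤ 1) {x : ℝ}
    (hx : |x| ∉ Set.Icc (1 - √l) (1 + √l)) : rgDensity l x = 0 := by
  have hr1 : √l ≤ 1 := Real.sqrt_le_one.2 hl
  rw [rgDensity, if_neg]
  rintro ⟨h1, h2⟩
  refine hx ⟨?_, ?_⟩
  · exact abs_of_nonneg (sub_nonneg.2 hr1) ▸ sq_le_sq.1 h1
  · exact abs_le_of_sq_le_sq h2 (by positivity)

theorem map_neg_rgMeasure {l : ℝ} (hl : 0 < l) :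
    (rgMeasure l).map (fun x => -x) = rgMeasure l := by
  ext s hs
  rw [Measure.map_apply measurable_neg hs, rgMeasure, withDensity_apply _ (measurable_neg hs),
    withDensity_apply _ hs,
    ← (Measure.measurePreserving_neg (volume : Measure ℝ)).setLIntegral_comp_preimage hs
      (measurable_rgDensity hl).ennreal_ofReal]
  simp only [rgDensity_neg]

theorem rgMeasure_compl_support {l : ℝ} (hl : l ∈ Set.Ioc (0 : ℝ) 1) :
    rgMeasure l ((Set.Icc (-1 - √l) (-1 + √l) ∪ Set.Icc (1 - √l) (1 + √l))ᶜ) = 0 := by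
  have hm : MeasurableSet ((Set.Icc (-1 - √l) (-1 + √l) ∪ Set.Icc (1 - √l) (1 + √l))ᶜ) :=
    (measurableSet_Icc.union measurableSet_Icc).compl
  rw [rgMeasure, withDensity_apply _ hm]
  refine setLIntegral_eq_zero hm fun x hx => ?_
  rw [rgDensity_eq_zero hl.2, ENNReal.ofReal_zero, Pi.zero_apply]
  simp only [Set.mem_compl_iff, Set.mem_union, Set.mem_Icc, not_or] at hx ⊢
  rintro ⟨h1, h2⟩
  rcases abs_cases x with ⟨h, -⟩ | ⟨h, -⟩ <;> rw [h] at h1 h2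
  · exact hx.2 ⟨h1, h2⟩
  · exact hx.1 ⟨by linarith, by linarith⟩

theorem integral_rgMeasure {l : ℝ} (hl : 0 < l) (g : ℝ → ℝ) :
    ∫ x, g x ∂(rgMeasure l) = ∫ x, rgDensity l x * g x := by
  rw [rgMeasure, integral_withDensity_eq_integral_toReal_smul
    (measurable_rgDensity hl).ennreal_ofReal (by simp)]
  simp only [ENNReal.toReal_ofReal (rgDensity_nonneg hl _), smul_eq_mul]

theorem one_add_sq_add_mul_cos_pos {r : ℝ} (hr : 0 < r) {θ : ℝ}
    (hθ : θ ∈ Set.Ioo 0 π) : 0 < 1 + r ^ 2 + 2 * r * cos θ := by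
  have hc : -1 < cos θ := by
    rw [← Real.cos_pi]
    exact Real.cos_lt_cos_of_nonneg_of_le_pi hθ.1.le le_rfl hθ.2
  nlinarith [sq_nonneg (1 - r)]

theorem image_sqrt_one_add_sq_add_mul_cos {r : ℝ} (hr : 0 < r) (hr1 : r ≤ 1) :
    (fun θ => √(1 + r ^ 2 + 2 * r * cos θ)) '' Set.Ioo 0 π = Set.Ioo (1 - r) (1 + r) := by
  ext x
  constructor
  · rintro ⟨θ, hθ, rfl⟩
    have hc : -1 < cos θ := by
      rw [← Real.cos_pi]
      exact Real.cos_lt_cos_of_nonneg_of_le_pi hθ.1.le le_rfl hθ.2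
    have hc' : cos θ < 1 := by
      rw [← Real.cos_zero]
      exact Real.cos_lt_cos_of_nonneg_of_le_pi le_rfl hθ.2.le hθ.1
    constructor
    · exact Real.lt_sqrt_of_sq_lt (by nlinarith)
    · rw [Real.sqrt_lt' (by linarith)]; nlinarith
  · rintro ⟨h1, h2⟩
    have hx : 0 < x := by linarith
    have hlo : -1 < (x ^ 2 - 1 - r ^ 2) / (2 * r) := by
      rw [lt_div_iff₀ (by positivity)]; nlinarith
    have hhi : (x ^ 2 - 1 - r ^ 2) / (2 * r) < 1 := by
      rw [div_lt_iff₀ (by positivity)]; nlinarith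
    refine ⟨Real.arccos ((x ^ 2 - 1 - r ^ 2) / (2 * r)), ⟨Real.arccos_pos.2 hhi, ?_⟩, ?_⟩
    · refine lt_of_le_of_ne (Real.arccos_le_pi _) fun h => ?_
      exact absurd (Real.arccos_eq_pi.1 h) (not_le.2 hlo)
    · dsimp only
      rw [Real.cos_arccos hlo.le hhi.le, mul_div_cancel₀ _ (by positivity),
        show 1 + r ^ 2 + (x ^ 2 - 1 - r ^ 2) = x ^ 2 by ring, Real.sqrt_sq hx.le]

/-- The even moments in the parametrization `x ^ 2 = 1 + r ^ 2 + 2 r cos θ`. -/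
theorem integral_even_pow_rgMeasure {r : ℝ} (hr : 0 < r) (hr1 : r ≤ 1) (n : ℕ) :
    ∫ x, x ^ (2 * n) ∂(rgMeasure (r ^ 2)) = 2 / π * ∫ θ in (0 : ℝ)..π,
      sin θ ^ 2 / (1 + r ^ 2 + 2 * r * cos θ) * (1 + r ^ 2 + 2 * r * cos θ) ^ n := by
  have hl : 0 < r ^ 2 := by positivity
  rw [integral_rgMeasure hl]
  have habs : ∀ x : ℝ, rgDensity (r ^ 2) x * x ^ (2 * n) =
      (fun t => rgDensity (r ^ 2) t * t ^ (2 * n)) |x| := fun x => by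
    simp only [rgDensity_abs, pow_mul, sq_abs]
  rw [integral_congr_ae (Filter.Eventually.of_forall habs),
    integral_comp_abs (f := fun t => rgDensity (r ^ 2) t * t ^ (2 * n)),
    setIntegral_eq_of_subset_of_forall_sdiff_eq_zero
    (s := Set.Ioo (1 - r) (1 + r)) measurableSet_Ioi
    (fun x hx => Set.mem_Ioi.2 (by linarith [hx.1])), ← image_sqrt_one_add_sq_add_mul_cos hr hr1,
    integral_image_eq_integral_abs_deriv_smul measurableSet_Ioo
      (f' := fun θ => -(2 * r * sin θ) / (2 * √(1 + r ^ 2 + 2 * r * cos θ))),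
    intervalIntegral.integral_of_le Real.pi_pos.le, integral_Ioc_eq_integral_Ioo,
    ← integral_const_mul, ← integral_const_mul]
  · refine setIntegral_congr_fun measurableSet_Ioo fun θ hθ => ?_
    have hs : 0 < sin θ := Real.sin_pos_of_mem_Ioo hθ
    have hy := one_add_sq_add_mul_cos_pos hr hθ
    have hy2 := Real.sq_sqrt hy.le
    have hy0 := Real.sqrt_pos.2 hy
    rw [rgDensity_eq hl, pow_mul, hy2]
    rw [show 4 * r ^ 2 - (1 + r ^ 2 + 2 * r * cos θ - 1 - r ^ 2) ^ 2 = (2 * r * sin θ) ^ 2 by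
      rw [mul_pow _ (sin θ), Real.sin_sq]; ring, Real.sqrt_sq (by positivity), neg_div, abs_neg,
      abs_of_pos (by positivity), abs_of_pos hy0, smul_eq_mul]
    have hpi := Real.pi_pos
    generalize (1 + r ^ 2 + 2 * r * cos θ) ^ n = z
    generalize 1 + r ^ 2 + 2 * r * cos θ = y at *
    rw [← hy2, Real.sqrt_sq hy0.le]
    field_simp
  · intro θ hθ
    have h : HasDerivAt (fun θ => 1 + r ^ 2 + 2 * r * cos θ) (-(2 * r * sin θ)) θ := by
      simpa using ((Real.hasDerivAt_cos θ).const_mul (2 * r)).const_add (1 + r ^ 2)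
    exact (h.sqrt (one_add_sq_add_mul_cos_pos hr hθ).ne').hasDerivWithinAt
  · intro θ hθ φ hφ h
    have h' := (Real.sqrt_inj (one_add_sq_add_mul_cos_pos hr hθ).le
      (one_add_sq_add_mul_cos_pos hr hφ).le).1 h
    refine Real.injOn_cos ⟨hθ.1.le, hθ.2.le⟩ ⟨hφ.1.le, hφ.2.le⟩ ?_
    exact mul_left_cancel₀ (by positivity : 2 * r ≠ 0) (add_left_cancel h')
  · rintro x ⟨hx, hx'⟩
    have hx0 : 0 < x := hx
    have hneg : 4 * r ^ 2 - (x ^ 2 - 1 - r ^ 2) ^ 2 ≤ 0 := by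
      rw [show 4 * r ^ 2 - (x ^ 2 - 1 - r ^ 2) ^ 2 =
        -((x - (1 - r)) * (x - (1 + r)) * ((x + (1 - r)) * (x + (1 + r)))) by ring, neg_nonpos]
      refine mul_nonneg ?_ (mul_nonneg (by linarith) (by linarith))
      rw [Set.mem_Ioo, not_and_or, not_lt, not_lt] at hx'
      rcases hx' with h | h
      · exact mul_nonneg_of_nonpos_of_nonpos (by linarith) (by linarith)
      · exact mul_nonneg (by linarith) (by linarith)
    rw [rgDensity_eq hl, Real.sqrt_eq_zero_of_nonpos hneg, zero_div, zero_mul]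

/-- The normalization of the Poisson kernel. -/
theorem integral_poisson_kernel {r : ℝ} (hr : 0 < r) (hr1 : r < 1) :
    ∫ θ in (0 : ℝ)..π, (1 - r ^ 2) / (1 + r ^ 2 + 2 * r * cos θ) = π := by
  have hpos : ∀ θ : ℝ, 0 < 1 + r * cos θ := fun θ => by nlinarith [Real.neg_one_le_cos θ]
  have hy : ∀ θ : ℝ, 0 < 1 + r ^ 2 + 2 * r * cos θ := fun θ => by
    nlinarith [Real.neg_one_le_cos θ, sq_pos_of_pos (sub_pos.2 hr1)]
  have hd : ∀ θ : ℝ, HasDerivAt (fun θ => θ - 2 * Real.arctan (r * sin θ / (1 + r * cos θ)))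
      ((1 - r ^ 2) / (1 + r ^ 2 + 2 * r * cos θ)) θ := by
    intro θ
    have h := (hasDerivAt_id θ).sub (((((Real.hasDerivAt_sin θ).const_mul r).div
      (((Real.hasDerivAt_cos θ).const_mul r).const_add 1) (hpos θ).ne').arctan).const_mul 2)
    refine h.congr_deriv ?_
    have h1 := (hpos θ).ne'
    have h2 := (hy θ).ne'
    have hsc := Real.sin_sq_add_cos_sq θ
    have h3 : 1 + (r * sin θ / (1 + r * cos θ)) ^ 2 =
        (1 + r ^ 2 + 2 * r * cos θ) / (1 + r * cos θ) ^ 2 := by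
      field_simp
      linear_combination r ^ 2 * hsc
    rw [Pi.div_apply, h3]
    generalize hY : 1 + r ^ 2 + 2 * r * cos θ = y at *
    field_simp
    subst hY
    linear_combination (-2 * r ^ 2) * hsc
  rw [intervalIntegral.integral_eq_sub_of_hasDerivAt (fun θ _ => hd θ)]
  · simp
  · exact (Continuous.div (by fun_prop) (by fun_prop) fun θ => (hy θ).ne').intervalIntegrable _ _

theorem integral_sin_sq_div {r : ℝ} (hr : 0 < r) (hr1 : r ≤ 1) :
    ∫ θ in (0 : ℝ)..π, sin θ ^ 2 / (1 + r ^ 2 + 2 * r * cos θ) = π / 2 := by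
  have hsplit : ∀ θ ∈ Set.Ioo 0 π, sin θ ^ 2 / (1 + r ^ 2 + 2 * r * cos θ) =
      1 / (4 * r ^ 2) * ((1 + r ^ 2 - 2 * r * cos θ) -
        (1 - r ^ 2) * ((1 - r ^ 2) / (1 + r ^ 2 + 2 * r * cos θ))) := by
    intro θ hθ
    have hy := (one_add_sq_add_mul_cos_pos hr hθ).ne'
    have hsc := Real.sin_sq_add_cos_sq θ
    generalize hY : 1 + r ^ 2 + 2 * r * cos θ = y at *
    field_simp
    subst hY
    linear_combination (4 * r ^ 2) * hsc
  have hlin : ∫ θ in (0 : ℝ)..π, (1 + r ^ 2 - 2 * r * cos θ) = (1 + r ^ 2) * π := by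
    rw [intervalIntegral.integral_sub (by simp)
      (Continuous.intervalIntegrable (by fun_prop) _ _), intervalIntegral.integral_const_mul]
    simp [mul_add, mul_comm]
  have hpoisson : IntervalIntegrable
      (fun θ => (1 - r ^ 2) * ((1 - r ^ 2) / (1 + r ^ 2 + 2 * r * cos θ))) volume 0 π ∧
      ∫ θ in (0 : ℝ)..π, (1 - r ^ 2) * ((1 - r ^ 2) / (1 + r ^ 2 + 2 * r * cos θ)) =
        (1 - r ^ 2) * π := by
    rcases hr1.lt_or_eq with h | rfl
    · refine ⟨?_, by rw [intervalIntegral.integral_const_mul, integral_poisson_kernel hr h]⟩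
      refine (Continuous.mul continuous_const (Continuous.div (by fun_prop) (by fun_prop)
        fun θ => ?_)).intervalIntegrable _ _
      nlinarith [Real.neg_one_le_cos θ, sq_pos_of_pos (sub_pos.2 h)]
    · simp
  calc _ = ∫ θ in (0 : ℝ)..π, 1 / (4 * r ^ 2) * ((1 + r ^ 2 - 2 * r * cos θ) -
        (1 - r ^ 2) * ((1 - r ^ 2) / (1 + r ^ 2 + 2 * r * cos θ))) := by
        rw [intervalIntegral.integral_of_le Real.pi_pos.le,
          intervalIntegral.integral_of_le Real.pi_pos.le, integral_Ioc_eq_integral_Ioo,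
          integral_Ioc_eq_integral_Ioo]
        exact setIntegral_congr_fun measurableSet_Ioo hsplit
    _ = _ := by
        rw [intervalIntegral.integral_const_mul, intervalIntegral.integral_sub
          (Continuous.intervalIntegrable (by fun_prop) _ _) hpoisson.1, hlin, hpoisson.2]
        field_simp
        ring

theorem integral_rgDensity {r : ℝ} (hr : 0 < r) (hr1 : r ≤ 1) :
    ∫ x, rgDensity (r ^ 2) x = 1 := by
  have h := integral_even_pow_rgMeasure hr hr1 0
  rw [integral_rgMeasure (by positivity)] at h
  simp only [mul_zero, pow_zero, mul_one] at h
  rw [h, integral_sin_sq_div hr hr1]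
  have := Real.pi_ne_zero
  field_simp

theorem isProbabilityMeasure_rgMeasure {r : ℝ} (hr : 0 < r) (hr1 : r ≤ 1) :
    IsProbabilityMeasure (rgMeasure (r ^ 2)) := by
  have h := integral_rgDensity hr hr1
  constructor
  rw [rgMeasure, withDensity_apply _ MeasurableSet.univ, Measure.restrict_univ,
    ← ofReal_integral_eq_lintegral_ofReal (integrable_of_integral_eq_one h)
      (Filter.Eventually.of_forall (rgDensity_nonneg (by positivity))), h, ENNReal.ofReal_one]

open Polynomial in
theorem integral_pow_two_mul_succ_rgMeasure {r : ℝ} (hr : 0 < r) (hr1 : r ≤ 1) (n : ℕ) :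
    ∫ x, x ^ (2 * (n + 1)) ∂(rgMeasure (r ^ 2)) =
      semicircle ((C (1 + r ^ 2) + C r * X) ^ n) := by
  rw [integral_even_pow_rgMeasure hr hr1, semicircle_apply,
    intervalIntegral.integral_of_le Real.pi_pos.le,
    intervalIntegral.integral_of_le Real.pi_pos.le, integral_Ioc_eq_integral_Ioo,
    integral_Ioc_eq_integral_Ioo]
  refine congrArg _ (setIntegral_congr_fun measurableSet_Ioo fun θ hθ => ?_)
  have hy := (one_add_sq_add_mul_cos_pos hr hθ).ne'
  simp only [Polynomial.eval_pow, Polynomial.eval_add, Polynomial.eval_mul, Polynomial.eval_C,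
    Polynomial.eval_X]
  rw [show r * (2 * cos θ) = 2 * r * cos θ by ring]
  generalize 1 + r ^ 2 + 2 * r * cos θ = y at *
  field_simp
  ring

theorem integral_odd_pow_rgMeasure {l : ℝ} (hl : 0 < l) (n : ℕ) :
    ∫ x, x ^ (2 * n + 1) ∂(rgMeasure l) = 0 := by
  have h : ∫ x, x ^ (2 * n + 1) ∂(rgMeasure l) = -∫ x, x ^ (2 * n + 1) ∂(rgMeasure l) := by
    conv_lhs => rw [← map_neg_rgMeasure hl]
    rw [integral_map measurable_neg.aemeasurable (by fun_prop)]
    simp only [Odd.neg_pow (odd_two_mul_add_one n), integral_neg]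
  linarith

/-- for `λ ∈ (0,1]`, the function `rgDensity λ` is the density of a symmetric
probability measure `ν` supported on `[-1-√λ, -1+√λ] ∪ [1-√λ, 1+√λ]`, whose `2n`-th moment
is `∑_π λ^{e(π)}` (sum over noncrossing pairings `π` of `{1,…,2n}`) and whose odd moments
all vanish. -/
theorem stmt9 (l : ℝ) (hl : l ∈ Set.Ioc (0:ℝ) 1) :
    IsProbabilityMeasure (rgMeasure l) ∧
    (rgMeasure l).map (fun x => -x) = rgMeasure l ∧
    rgMeasure l ((Set.Icc (-1 - Real.sqrt l) (-1 + Real.sqrt l) ∪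
        Set.Icc (1 - Real.sqrt l) (1 + Real.sqrt l))ᶜ) = 0 ∧
    (∀ n : ℕ, 1 ≤ n →
      ∫ x, x ^ (2 * n) ∂(rgMeasure l) = ∑ P ∈ ncPairings (2 * n), l ^ eCount P) ∧
    (∀ n : ℕ, ∫ x, x ^ (2 * n + 1) ∂(rgMeasure l) = 0) := by
  obtain ⟨r, hr, hr1, rfl⟩ : ∃ r : ℝ, 0 < r ∧ r ≤ 1 ∧ l = r ^ 2 :=
    ⟨√l, Real.sqrt_pos.2 hl.1, Real.sqrt_le_one.2 hl.2, (Real.sq_sqrt hl.1.le).symm⟩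
  refine ⟨isProbabilityMeasure_rgMeasure hr hr1, map_neg_rgMeasure hl.1,
    rgMeasure_compl_support hl, fun n hn => ?_, integral_odd_pow_rgMeasure hl.1⟩
  obtain ⟨n, rfl⟩ := Nat.exists_eq_succ_of_ne_zero (Nat.one_le_iff_ne_zero.1 hn)
  rw [Nat.succ_eq_add_one, integral_pow_two_mul_succ_rgMeasure hr hr1,
    ncPairings_eq_ncPairingsIco]
  symm
  refine ncWeight_one_eq_of_recurrence (r ^ 2)
    (fun n => semicircle ((Polynomial.C (1 + r ^ 2) + Polynomial.C r * Polynomial.X) ^ n)) ?_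
    (affine_moment_recurrence semicircle semicircle_X_pow_succ (1 + r ^ 2) r) n
  have h := semicircle_X_pow_even 0
  simpa using h
end
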